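/- Assume g satisfies conditions (2.4) and let N ≥ 2. Let Ω₀ and Ω₁ be bounded convex open subsets of ℝ^N with closure(Ω₁) ⊂ Ω₀, set Ω = Ω₀ \ closure(Ω₁), Γ₀ = ∂Ω₀ and Γ₁ = ∂Ω₁. Let q₀ > 0 and c₁ > 0, and suppose u is C³ on an open neighborhood of closure(Ω), satisfies Σ_{i=1}^N ∂_i(g(q²) ∂_i u) = N in Ω with q = |∇u| and ∇u ≠ 0 in Ω, and satisfies the overdetermined boundary conditions u = 0 and |∇u| = q₀ on Γ₀, u = −c₁ and ∇u = 0 on Γ₁. Then the strict inequalities (1/N)∫₀^{q₀} s G(s²) ds < c₁ < ∫₀^{q₀} s G(s²) ds hold. -/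

import Mathlib

open Set Filter

noncomputable section

/-- `G(ξ) = g(ξ) + 2ξ g'(ξ)`, from (1.2). -/
def Gfun (g : ℝ → ℝ) (ξ : ℝ) : ℝ := g ξ + 2 * ξ * deriv g ξ

/-- Conditions (2.4) on `g`. -/
def Cond24 (g : ℝ → ℝ) : Prop :=
  ContDiffOn ℝ (⊤ : ℕ∞) g (Ioi 0) ∧ (∀ ξ > (0:ℝ), 0 < g ξ) ∧
  Tendsto (fun ξ : ℝ => g (ξ ^ 2) * ξ) (nhdsWithin 0 (Ioi 0)) (nhds 0) ∧
  Tendsto (fun ξ : ℝ => g (ξ ^ 2) * ξ) atTop atTop ∧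
  (∀ ξ > (0:ℝ), 0 < Gfun g ξ)

/-- The `i`-th standard basis vector of `ℝ^N`. -/
def eb (N : ℕ) (i : Fin N) : EuclideanSpace ℝ (Fin N) := EuclideanSpace.single i 1

/-- The scalar flux `s ↦ g(s²) s`, an odd increasing bijection of `ℝ` under `Cond24`. -/
def flux (g : ℝ → ℝ) (s : ℝ) : ℝ := g (s ^ 2) * s

/-- The inverse of the scalar flux. -/
def fluxInv (g : ℝ → ℝ) : ℝ → ℝ := Function.invFun (flux g)

/-- The primitive of the inverse flux. -/
def pot (g : ℝ → ℝ) (t : ℝ) : ℝ := ∫ s in (0 : ℝ)..t, fluxInv g s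

namespace Cond24

variable {g : ℝ → ℝ}

theorem pos (hg : Cond24 g) {ξ : ℝ} (h : 0 < ξ) : 0 < g ξ := hg.2.1 ξ h

theorem Gfun_pos (hg : Cond24 g) {ξ : ℝ} (h : 0 < ξ) : 0 < Gfun g ξ := hg.2.2.2.2 ξ h

theorem contDiffAt (hg : Cond24 g) {ξ : ℝ} (h : 0 < ξ) : ContDiffAt ℝ (⊤ : ℕ∞) g ξ :=
  (hg.1 ξ h).contDiffAt (Ioi_mem_nhds h)

theorem hasDerivAt (hg : Cond24 g) {ξ : ℝ} (h : 0 < ξ) : HasDerivAt g (deriv g ξ) ξ :=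
  ((hg.contDiffAt h).differentiableAt (by simp)).hasDerivAt

end Cond24

theorem flux_zero (g : ℝ → ℝ) : flux g 0 = 0 := by simp [flux]

theorem flux_neg (g : ℝ → ℝ) (s : ℝ) : flux g (-s) = -flux g s := by simp [flux]

theorem hasDerivAt_flux {g : ℝ → ℝ} (hg : Cond24 g) {s : ℝ} (hs : s ≠ 0) :
    HasDerivAt (flux g) (Gfun g (s ^ 2)) s := by
  have h1 : HasDerivAt (fun s : ℝ => s ^ 2) (2 * s) s := by
    simpa using hasDerivAt_pow 2 s
  have hp : 0 < s ^ 2 := by positivity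
  have h2 : HasDerivAt (fun s => g (s ^ 2)) (deriv g (s ^ 2) * (2 * s)) s :=
    HasDerivAt.comp s (h := fun s : ℝ => s ^ 2) (hg.hasDerivAt hp) h1
  refine (h2.mul (hasDerivAt_id s)).congr_deriv ?_
  simp only [Gfun, id]
  ring

theorem continuous_flux {g : ℝ → ℝ} (hg : Cond24 g) : Continuous (flux g) := by
  rw [continuous_iff_continuousAt]
  intro s
  rcases eq_or_ne s 0 with rfl | hs
  · have h1 : Tendsto (flux g) (nhdsWithin 0 (Ioi 0)) (nhds 0) := hg.2.2.1
    have h2 : Tendsto (flux g) (nhdsWithin 0 (Iio 0)) (nhds 0) := by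
      have hneg : Tendsto (fun s : ℝ => -s) (nhdsWithin 0 (Iio 0)) (nhdsWithin 0 (Ioi 0)) := by
        simpa using tendsto_neg_nhdsLT (a := (0 : ℝ))
      have := (h1.comp hneg).neg
      simpa [Function.comp_def, flux_neg] using this
    rw [continuousAt_iff_punctured_nhds, flux_zero, ← Iio_union_Ioi, nhdsWithin_union]
    exact h2.sup h1
  · exact (hasDerivAt_flux hg hs).continuousAt

theorem strictMono_flux {g : ℝ → ℝ} (hg : Cond24 g) : StrictMono (flux g) := by
  have h1 : StrictMonoOn (flux g) (Ici 0) := by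
    refine strictMonoOn_of_deriv_pos (convex_Ici 0) (continuous_flux hg).continuousOn ?_
    intro s hs
    rw [interior_Ici] at hs
    have hs' : (0 : ℝ) < s := hs
    rw [(hasDerivAt_flux hg hs'.ne').deriv]
    exact hg.Gfun_pos (by positivity)
  have h2 : StrictMonoOn (flux g) (Iic 0) := by
    intro a ha b hb hab
    have := h1 (show -b ∈ Ici (0 : ℝ) by simpa using hb) (show -a ∈ Ici (0 : ℝ) by simpa using ha)
      (neg_lt_neg hab)
    rw [flux_neg, flux_neg] at this
    linarith
  exact h2.Iic_union_Ici h1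

theorem surjective_flux {g : ℝ → ℝ} (hg : Cond24 g) : Function.Surjective (flux g) := by
  have h1 : Tendsto (flux g) atTop atTop := hg.2.2.2.1
  refine (continuous_flux hg).surjective h1 ?_
  have := tendsto_neg_atTop_atBot.comp (h1.comp tendsto_neg_atBot_atTop)
  simpa [Function.comp_def, flux_neg] using this

theorem fluxInv_flux {g : ℝ → ℝ} (hg : Cond24 g) (s : ℝ) : fluxInv g (flux g s) = s :=
  Function.leftInverse_invFun (strictMono_flux hg).injective s

theorem flux_fluxInv {g : ℝ → ℝ} (hg : Cond24 g) (t : ℝ) : flux g (fluxInv g t) = t :=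
  Function.rightInverse_invFun (surjective_flux hg) t

theorem strictMono_fluxInv {g : ℝ → ℝ} (hg : Cond24 g) : StrictMono (fluxInv g) := by
  intro a b hab
  rw [← (strictMono_flux hg).lt_iff_lt, flux_fluxInv hg, flux_fluxInv hg]
  exact hab

theorem fluxInv_zero {g : ℝ → ℝ} (hg : Cond24 g) : fluxInv g 0 = 0 := by
  simpa [flux_zero] using fluxInv_flux hg 0

theorem fluxInv_pos {g : ℝ → ℝ} (hg : Cond24 g) {t : ℝ} (ht : 0 < t) : 0 < fluxInv g t := by
  simpa [fluxInv_zero hg] using strictMono_fluxInv hg ht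

theorem flux_pos {g : ℝ → ℝ} (hg : Cond24 g) {s : ℝ} (hs : 0 < s) : 0 < flux g s := by
  simpa [flux_zero] using strictMono_flux hg hs

theorem continuous_fluxInv {g : ℝ → ℝ} (hg : Cond24 g) : Continuous (fluxInv g) :=
  (strictMono_fluxInv hg).monotone.continuous_of_surjective
    fun s => ⟨flux g s, fluxInv_flux hg s⟩

theorem fluxInv_ne_zero {g : ℝ → ℝ} (hg : Cond24 g) {t : ℝ} (ht : t ≠ 0) : fluxInv g t ≠ 0 :=
  fun h => ht (by rw [← flux_fluxInv hg t, h, flux_zero])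

theorem hasDerivAt_fluxInv {g : ℝ → ℝ} (hg : Cond24 g) {t : ℝ} (ht : t ≠ 0) :
    HasDerivAt (fluxInv g) (Gfun g (fluxInv g t ^ 2))⁻¹ t := by
  have h := fluxInv_ne_zero hg ht
  exact (hasDerivAt_flux hg h).of_local_left_inverse (continuous_fluxInv hg).continuousAt
    (hg.Gfun_pos (by positivity)).ne' (Eventually.of_forall (flux_fluxInv hg))

theorem hasDerivAt_pot {g : ℝ → ℝ} (hg : Cond24 g) (t : ℝ) :
    HasDerivAt (pot g) (fluxInv g t) t :=
  (continuous_fluxInv hg).integral_hasStrictDerivAt 0 t |>.hasDerivAt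

theorem continuous_pot {g : ℝ → ℝ} (hg : Cond24 g) : Continuous (pot g) :=
  continuous_iff_continuousAt.2 fun t => (hasDerivAt_pot hg t).continuousAt

theorem pot_zero (g : ℝ → ℝ) : pot g 0 = 0 := by simp [pot]

theorem strictMonoOn_pot {g : ℝ → ℝ} (hg : Cond24 g) : StrictMonoOn (pot g) (Ici 0) := by
  refine strictMonoOn_of_deriv_pos (convex_Ici 0) (continuous_pot hg).continuousOn ?_
  intro s hs
  rw [interior_Ici] at hs
  rw [(hasDerivAt_pot hg s).deriv]
  exact fluxInv_pos hg hs

theorem strictConvexOn_pot {g : ℝ → ℝ} (hg : Cond24 g) : StrictConvexOn ℝ univ (pot g) := by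
  refine StrictMono.strictConvexOn_univ_of_deriv (continuous_pot hg) ?_
  have : deriv (pot g) = fluxInv g := funext fun t => (hasDerivAt_pot hg t).deriv
  rw [this]
  exact strictMono_fluxInv hg

theorem hasDerivAt_pot_flux {g : ℝ → ℝ} (hg : Cond24 g) {s : ℝ} (hs : s ≠ 0) :
    HasDerivAt (fun s => pot g (flux g s)) (s * Gfun g (s ^ 2)) s := by
  have := (hasDerivAt_pot hg (flux g s)).comp s (hasDerivAt_flux hg hs)
  rwa [fluxInv_flux hg] at this

theorem integral_eq_pot_flux {g : ℝ → ℝ} (hg : Cond24 g) {q : ℝ} (hq : 0 < q) :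
    ∫ s in (0 : ℝ)..q, s * Gfun g (s ^ 2) = pot g (flux g q) := by
  have hc : ContinuousOn (fun s => pot g (flux g s)) (Icc 0 q) :=
    ((continuous_pot hg).comp (continuous_flux hg)).continuousOn
  have hd : ∀ s ∈ Ioo (0 : ℝ) q,
      HasDerivAt (fun s => pot g (flux g s)) (s * Gfun g (s ^ 2)) s :=
    fun s hs => hasDerivAt_pot_flux hg hs.1.ne'
  have hi := intervalIntegral.integrableOn_deriv_of_nonneg hc hd fun s hs =>
    mul_nonneg hs.1.le (hg.Gfun_pos (by have := hs.1; positivity)).le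
  rw [intervalIntegral.integral_eq_sub_of_hasDerivAt_of_le hq.le hc hd
    ((intervalIntegrable_iff_integrableOn_Ioc_of_le hq.le).2 hi)]
  simp [flux_zero, pot_zero]

section SecondOrder

open scoped InnerProductSpace

variable {E : Type*} [NormedAddCommGroup E] [InnerProductSpace ℝ E]
  {ι : Type*} [Fintype ι]

theorem IsLocalMax.inner_fderiv_gradient_nonpos [CompleteSpace E] {f : E → ℝ} {D : E → E}
    {Q : E →L[ℝ] E} {x : E} (hmax : IsLocalMax f x) (hD : ∀ᶠ y in nhds x, HasGradientAt f (D y) y)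
    (hQ : HasFDerivAt D Q x) (e : E) : ⟪Q e, e⟫_ℝ ≤ 0 := by
  by_contra! hpos
  have hline : ∀ t : ℝ, HasDerivAt (fun t : ℝ => x + t • e) e t := fun t => by
    simpa using ((hasDerivAt_id t).smul_const e).const_add x
  have hcont : Tendsto (fun t : ℝ => x + t • e) (nhds 0) (nhds x) := by
    simpa using (hline 0).continuousAt.tendsto
  have h1 : ∀ᶠ t in nhds (0 : ℝ),
      HasDerivAt (fun t : ℝ => f (x + t • e)) ⟪D (x + t • e), e⟫_ℝ t := by
    filter_upwards [hcont.eventually hD] with t ht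
    exact (ht.hasFDerivAt.comp_hasDerivAt t (hline t)).congr_deriv (by simp)
  have h2 : deriv (fun t : ℝ => f (x + t • e)) =ᶠ[nhds 0] fun t => ⟪D (x + t • e), e⟫_ℝ :=
    h1.mono fun t ht => ht.deriv
  have h3 : HasDerivAt (fun t : ℝ => ⟪D (x + t • e), e⟫_ℝ) ⟪Q e, e⟫_ℝ 0 := by
    have hQ' : HasFDerivAt D Q (x + (0 : ℝ) • e) := by simpa using hQ
    simpa using (hQ'.comp_hasDerivAt (0 : ℝ) (hline 0)).inner ℝ (hasDerivAt_const (0 : ℝ) e)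
  have hmax0 : IsLocalMax (fun t : ℝ => f (x + t • e)) 0 := by
    have := hcont.eventually hmax
    simpa [IsLocalMax, IsMaxFilter] using this
  have hmin : IsLocalMin (fun t : ℝ => f (x + t • e)) 0 :=
    isLocalMin_of_deriv_deriv_pos (by rw [h2.deriv_eq, h3.deriv]; exact hpos) hmax0.deriv_eq_zero
      h1.self_of_nhds.continuousAt
  have hconst : (fun t : ℝ => f (x + t • e)) =ᶠ[nhds 0] fun _ => f (x + (0 : ℝ) • e) := by
    filter_upwards [hmax0, hmin] with t h h' using le_antisymm h h'
  have h4 := (h2.symm.trans hconst.deriv).deriv_eq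
  rw [h3.deriv] at h4
  simp only [deriv_const'] at h4
  exact hpos.ne' h4

theorem OrthonormalBasis.sum_inner_mul_inner_apply [CompleteSpace E]
    (b : OrthonormalBasis ι ℝ E) (Q : E →L[ℝ] E) (n m : E) :
    ∑ i, ⟪n, b i⟫_ℝ * ⟪Q (b i), m⟫_ℝ = ⟪Q n, m⟫_ℝ := by
  simp only [← ContinuousLinearMap.adjoint_inner_right]
  exact b.sum_inner_mul_inner n _

theorem OrthonormalBasis.sum_inner_sq (b : OrthonormalBasis ι ℝ E) (n : E) :
    ∑ i, ⟪n, b i⟫_ℝ ^ 2 = ‖n‖ ^ 2 := by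
  rw [← real_inner_self_eq_norm_sq, ← b.sum_inner_mul_inner n n]
  exact Finset.sum_congr rfl fun i _ => by rw [sq, real_inner_comm n (b i)]

/-- The trace of the product of a positive semidefinite matrix `a I + c p ⊗ p` with a matrix
whose quadratic form is nonpositive is nonpositive. -/
theorem OrthonormalBasis.weighted_trace_nonpos [CompleteSpace E]
    (b : OrthonormalBasis ι ℝ E) {Q : E →L[ℝ] E} (hQ : ∀ e, ⟪Q e, e⟫_ℝ ≤ 0) {p : E} {a c : ℝ}
    (ha : 0 ≤ a) (hac : 0 ≤ a + c * ‖p‖ ^ 2) :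
    a * ∑ i, ⟪Q (b i), b i⟫_ℝ + c * ⟪Q p, p⟫_ℝ ≤ 0 := by
  rcases eq_or_ne p 0 with rfl | hp
  · simpa using mul_nonpos_of_nonneg_of_nonpos ha (Finset.sum_nonpos fun i _ => hQ (b i))
  have hp' : 0 < ‖p‖ := norm_pos_iff.2 hp
  obtain ⟨n, hn, hpn⟩ : ∃ n : E, ‖n‖ = 1 ∧ p = ‖p‖ • n :=
    ⟨‖p‖⁻¹ • p, norm_smul_inv_norm hp, by rw [smul_smul, mul_inv_cancel₀ hp'.ne', one_smul]⟩
  have hQp : ⟪Q p, p⟫_ℝ = ‖p‖ ^ 2 * ⟪Q n, n⟫_ℝ := by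
    conv_lhs => rw [hpn]
    rw [map_smul, real_inner_smul_left, real_inner_smul_right]
    ring
  have hproj : ∑ i, ⟪Q (b i), b i⟫_ℝ - ⟪Q n, n⟫_ℝ ≤ 0 := by
    have h : ∑ i, ⟪Q (b i - ⟪n, b i⟫_ℝ • n), b i - ⟪n, b i⟫_ℝ • n⟫_ℝ
        = ∑ i, ⟪Q (b i), b i⟫_ℝ - ⟪Q n, n⟫_ℝ := by
      have h1 := b.sum_inner_mul_inner_apply Q n n
      have h2 : ∑ i, ⟪n, b i⟫_ℝ * ⟪Q n, b i⟫_ℝ = ⟪Q n, n⟫_ℝ := by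
        rw [real_inner_comm, ← b.sum_inner_mul_inner n (Q n)]
        exact Finset.sum_congr rfl fun i _ => by rw [real_inner_comm (b i) (Q n)]
      have h3 := b.sum_inner_sq n
      have h4 : ∀ i, ⟪Q (b i - ⟪n, b i⟫_ℝ • n), b i - ⟪n, b i⟫_ℝ • n⟫_ℝ
          = ⟪Q (b i), b i⟫_ℝ - ⟪n, b i⟫_ℝ * ⟪Q (b i), n⟫_ℝ - ⟪n, b i⟫_ℝ * ⟪Q n, b i⟫_ℝ
            + ⟪n, b i⟫_ℝ ^ 2 * ⟪Q n, n⟫_ℝ := fun i => by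
        simp only [map_sub, map_smul, inner_sub_left, inner_sub_right, real_inner_smul_left,
          real_inner_smul_right]
        ring
      simp only [h4, Finset.sum_add_distrib, Finset.sum_sub_distrib, h1, h2, ← Finset.sum_mul, h3,
        hn]
      ring
    rw [← h]
    exact Finset.sum_nonpos fun i _ => hQ _
  rw [hQp]
  nlinarith [mul_nonpos_of_nonneg_of_nonpos ha hproj, mul_nonpos_of_nonneg_of_nonpos hac (hQ n)]

/-- The algebraic inequality behind the maximum principle for the `P`-functions. -/
theorem OrthonormalBasis.mul_trace_le {N : ℕ} (hN : 2 ≤ N) (b : OrthonormalBasis (Fin N) ℝ E)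
    {H : E →L[ℝ] E} (hH : ∀ v w, ⟪H v, w⟫_ℝ = ⟪v, H w⟫_ℝ) {p : E} (hp : p ≠ 0) {a c β : ℝ}
    (ha : 0 < a) (hac : 0 < a + c * ‖p‖ ^ 2) (hcrit : (a + c * ‖p‖ ^ 2) • H p = β • p)
    (htr : a * ∑ i, ⟪H (b i), b i⟫_ℝ + c * ⟪H p, p⟫_ℝ = N)
    (hβ : 0 ≤ (N - β) * (1 - β)) :
    β * ∑ i, ⟪H (b i), b i⟫_ℝ ≤ a * ∑ i, ‖H (b i)‖ ^ 2 + c * ‖H p‖ ^ 2 := by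
  have hp' : 0 < ‖p‖ := norm_pos_iff.2 hp
  obtain ⟨n, hn, hpn⟩ : ∃ n : E, ‖n‖ = 1 ∧ p = ‖p‖ • n :=
    ⟨‖p‖⁻¹ • p, norm_smul_inv_norm hp, by rw [smul_smul, mul_inv_cancel₀ hp'.ne', one_smul]⟩
  set τ := ∑ i, ⟪H (b i), b i⟫_ℝ
  set G := a + c * ‖p‖ ^ 2 with hG
  set η := β / G with hη
  have hβη : β = G * η := by rw [hη]; field_simp
  have hHp : H p = η • p := by
    rw [hη, div_eq_inv_mul, mul_smul, ← hcrit, smul_smul, inv_mul_cancel₀ hac.ne', one_smul]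
  have hHn : H n = η • n := by
    have : ‖p‖ • H n = ‖p‖ • (η • n) := by
      rw [← map_smul, ← hpn, hHp, smul_comm, ← hpn]
    exact smul_right_injective E hp'.ne' this
  have hN' : (2 : ℝ) ≤ N := by exact_mod_cast hN
  set κ := (τ - η) / (N - 1) with hκ
  have hκ' : τ - η = κ * (N - 1) := by rw [hκ]; field_simp [show (N : ℝ) - 1 ≠ 0 by linarith]
  have hsum : 0 ≤ ∑ i, ‖H (b i)‖ ^ 2 - η ^ 2 - κ ^ 2 * (N - 1) := by
    have h1 : ∀ i, ‖H (b i) - (κ • b i + ((η - κ) * ⟪n, b i⟫_ℝ) • n)‖ ^ 2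
        = ‖H (b i)‖ ^ 2 - 2 * κ * ⟪H (b i), b i⟫_ℝ + κ ^ 2
          - (η - κ) ^ 2 * ⟪n, b i⟫_ℝ ^ 2 := fun i => by
      have h2 : ⟪H (b i), n⟫_ℝ = η * ⟪n, b i⟫_ℝ := by
        rw [hH, hHn, real_inner_smul_right, real_inner_comm]
      have hb : ⟪b i, b i⟫_ℝ = 1 := by rw [real_inner_self_eq_norm_sq]; simp
      have hnn : ⟪n, n⟫_ℝ = 1 := by rw [real_inner_self_eq_norm_sq, hn]; simp
      rw [norm_sub_sq_real, ← real_inner_self_eq_norm_sq (κ • b i + _)]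
      simp only [inner_add_left, inner_add_right, real_inner_smul_left, real_inner_smul_right, h2,
        hb, hnn, real_inner_comm n (b i)]
      ring
    have h3 : 0 ≤ ∑ i, ‖H (b i) - (κ • b i + ((η - κ) * ⟪n, b i⟫_ℝ) • n)‖ ^ 2 :=
      Finset.sum_nonneg fun i _ => sq_nonneg _
    simp only [h1, Finset.sum_add_distrib, Finset.sum_sub_distrib, ← Finset.mul_sum,
      b.sum_inner_sq, hn] at h3
    simp only [Finset.sum_const, Finset.card_univ, Fintype.card_fin, nsmul_eq_mul] at h3
    have hτ : τ = κ * (N - 1) + η := by linarith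
    change 0 ≤ ∑ i, ‖H (b i)‖ ^ 2 - 2 * κ * τ + _ - _ at h3
    rw [hτ] at h3
    linarith
  have htr' : a * (κ * (N - 1)) = N - β := by
    rw [hHp, real_inner_smul_left, real_inner_self_eq_norm_sq] at htr
    rw [← hκ', hβη, hG]
    linarith
  have hHp2 : c * ‖H p‖ ^ 2 = (G - a) * η ^ 2 := by
    rw [hHp, norm_smul, mul_pow, Real.norm_eq_abs, sq_abs, hG]
    ring
  have hκβ : 0 ≤ κ * (N - 1) * (κ * a - β) := by
    have h1 : (N - β) * (κ * a * (N - 1) - β * (N - 1)) = N * ((N - β) * (1 - β)) := by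
      rw [show κ * a * (N - 1) = N - β by linarith]; ring
    have h2 : 0 ≤ a * (N - 1) * (κ * (N - 1) * (κ * a - β)) := by
      calc (0 : ℝ) ≤ N * ((N - β) * (1 - β)) := by positivity
        _ = _ := by rw [← h1, ← htr']; ring
    have h3 : 0 < a * ((N : ℝ) - 1) := mul_pos ha (by linarith)
    exact nonneg_of_mul_nonneg_right h2 h3
  have hτ : τ = κ * (N - 1) + η := by linarith
  rw [hHp2, hτ]
  rw [hβη] at hκβ ⊢
  nlinarith [mul_nonneg ha.le hsum]

end SecondOrder

section Equation

open scoped InnerProductSpace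

variable {E : Type*} [NormedAddCommGroup E] [InnerProductSpace ℝ E] [CompleteSpace E]
  {g : ℝ → ℝ} {u : E → ℝ} {x : E}

theorem ContDiffAt.hasGradientAt_gradient (hu : ContDiffAt ℝ 3 u x) :
    HasGradientAt u (gradient u x) x :=
  (hu.differentiableAt (by norm_num)).hasGradientAt

theorem ContDiffAt.gradient (hu : ContDiffAt ℝ 3 u x) : ContDiffAt ℝ 2 (gradient u) x := by
  have h : ContDiffAt ℝ 2 (fderiv ℝ u) x := hu.fderiv_right (by norm_num)
  exact (InnerProductSpace.toDual ℝ E).symm.contDiff.contDiffAt.comp x h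

theorem inner_gradient_eq_fderiv (u : E → ℝ) (x v : E) :
    ⟪gradient u x, v⟫_ℝ = fderiv ℝ u x v := by
  simp [gradient]

theorem ContDiffAt.inner_fderiv_gradient_comm (hu : ContDiffAt ℝ 3 u x) (v w : E) :
    ⟪fderiv ℝ (_root_.gradient u) x v, w⟫_ℝ = ⟪v, fderiv ℝ (_root_.gradient u) x w⟫_ℝ := by
  have hd : DifferentiableAt ℝ (_root_.gradient u) x := hu.gradient.differentiableAt (by norm_num)
  have h2 : DifferentiableAt ℝ (fderiv ℝ u) x :=
    (hu.fderiv_right (m := 2) (by norm_num)).differentiableAt (by norm_num)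
  have key : ∀ v w : E,
      ⟪fderiv ℝ (_root_.gradient u) x v, w⟫_ℝ = fderiv ℝ (fderiv ℝ u) x v w := fun v w => by
    have h3 := hd.hasFDerivAt.inner ℝ (hasFDerivAt_const w x)
    have h4 : HasFDerivAt (fun y => ⟪_root_.gradient u y, w⟫_ℝ)
        ((fderiv ℝ (fderiv ℝ u) x).flip w) x := by
      simp only [inner_gradient_eq_fderiv]
      exact (h2.hasFDerivAt.clm_apply (hasFDerivAt_const w x)).congr_fderiv (by ext; simp)
    simpa using congrArg (fun L : E →L[ℝ] ℝ => L v) (h3.unique h4)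
  have hs : IsSymmSndFDerivAt ℝ u x := hu.isSymmSndFDerivAt (by simp; norm_num)
  rw [key, real_inner_comm, key]
  exact hs.eq v w

/-- The vector flux `g(|∇u|²) ∇u`. -/
def vflux (g : ℝ → ℝ) (u : E → ℝ) (y : E) : E := g (‖gradient u y‖ ^ 2) • gradient u y

theorem hasFDerivAt_comp_norm_sq_gradient (hu : ContDiffAt ℝ 3 u x) {F : ℝ → ℝ} {F' : ℝ}
    (hF : HasDerivAt F F' (‖gradient u x‖ ^ 2)) :
    HasFDerivAt (fun y => F (‖gradient u y‖ ^ 2))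
      ((2 * F') • (innerSL ℝ (gradient u x)).comp (fderiv ℝ (gradient u) x)) x := by
  have hd : DifferentiableAt ℝ (gradient u) x := hu.gradient.differentiableAt (by norm_num)
  refine (hF.comp_hasFDerivAt x hd.hasFDerivAt.norm_sq).congr_fderiv ?_
  ext v
  simp
  ring

theorem hasFDerivAt_vflux (hg : Cond24 g) (hu : ContDiffAt ℝ 3 u x) (hx : gradient u x ≠ 0) :
    HasFDerivAt (vflux g u) (g (‖gradient u x‖ ^ 2) • fderiv ℝ (gradient u) x +
      ((2 * deriv g (‖gradient u x‖ ^ 2)) •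
        (innerSL ℝ (gradient u x)).comp (fderiv ℝ (gradient u) x)).smulRight (gradient u x)) x := by
  have hd : DifferentiableAt ℝ (gradient u) x := hu.gradient.differentiableAt (by norm_num)
  have hp : 0 < ‖gradient u x‖ ^ 2 := by have := norm_pos_iff.2 hx; positivity
  exact (hasFDerivAt_comp_norm_sq_gradient hu (hg.hasDerivAt hp)).smul hd.hasFDerivAt

theorem fderiv_vflux_apply (hg : Cond24 g) (hu : ContDiffAt ℝ 3 u x) (hx : gradient u x ≠ 0)
    (v : E) : fderiv ℝ (vflux g u) x v = g (‖gradient u x‖ ^ 2) • fderiv ℝ (gradient u) x v +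
      (2 * deriv g (‖gradient u x‖ ^ 2) * ⟪gradient u x, fderiv ℝ (gradient u) x v⟫_ℝ) •
        gradient u x := by
  rw [(hasFDerivAt_vflux hg hu hx).fderiv]
  simp

theorem contDiffAt_vflux (hg : Cond24 g) (hu : ContDiffAt ℝ 3 u x) (hx : gradient u x ≠ 0) :
    ContDiffAt ℝ 2 (vflux g u) x := by
  have hp : 0 < ‖gradient u x‖ ^ 2 := by have := norm_pos_iff.2 hx; positivity
  have h1 : ContDiffAt ℝ 2 (fun y => ‖gradient u y‖ ^ 2) x := hu.gradient.norm_sq ℝ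
  have h2 : ContDiffAt ℝ 2 g (‖gradient u x‖ ^ 2) :=
    (hg.contDiffAt hp).of_le (WithTop.coe_le_coe.2 (le_top : (2 : ℕ∞) ≤ ⊤))
  exact (h2.comp x (f := fun y => ‖gradient u y‖ ^ 2) h1).smul hu.gradient

theorem hasGradientAt_pot_flux (hg : Cond24 g) (hu : ContDiffAt ℝ 3 u x)
    (hx : gradient u x ≠ 0) :
    HasGradientAt (fun y => pot g (flux g ‖gradient u y‖))
      (Gfun g (‖gradient u x‖ ^ 2) • fderiv ℝ (gradient u) x (gradient u x)) x := by
  have hp : 0 < ‖gradient u x‖ := norm_pos_iff.2 hx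
  have h1 : HasDerivAt (fun t => pot g (flux g (Real.sqrt t)))
      (‖gradient u x‖ * Gfun g (‖gradient u x‖ ^ 2) * (1 / (2 * ‖gradient u x‖)))
      (‖gradient u x‖ ^ 2) := by
    have hs : Real.sqrt (‖gradient u x‖ ^ 2) = ‖gradient u x‖ := Real.sqrt_sq hp.le
    have h2 := Real.hasDerivAt_sqrt (x := ‖gradient u x‖ ^ 2) (by positivity)
    rw [hs] at h2
    exact HasDerivAt.comp (‖gradient u x‖ ^ 2) (h₂ := fun s => pot g (flux g s)) (h := Real.sqrt)
      (by rw [hs]; exact hasDerivAt_pot_flux hg hp.ne') h2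
  have h3 := hasFDerivAt_comp_norm_sq_gradient hu h1
  simp only [Real.sqrt_sq (norm_nonneg _)] at h3
  rw [hasGradientAt_iff_hasFDerivAt]
  refine h3.congr_fderiv ?_
  ext v
  simp only [smul_apply, ContinuousLinearMap.comp_apply, innerSL_apply_apply,
    smul_eq_mul, InnerProductSpace.toDual_apply_apply, real_inner_smul_left,
    hu.inner_fderiv_gradient_comm]
  field_simp

end Equation

section EquationP

open scoped InnerProductSpace

variable {E : Type*} [NormedAddCommGroup E] [InnerProductSpace ℝ E] {g : ℝ → ℝ} {u : E → ℝ} {x : E}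

/-- A function vanishing at `x`, multiplied by the matrix `a I + c p ⊗ p` of variable
coefficients. -/
theorem hasFDerivAt_smul_add_inner_smul {a c : E → ℝ} {D p : E → E} {Q : E →L[ℝ] E}
    (ha : DifferentiableAt ℝ a x) (hc : DifferentiableAt ℝ c x) (hp : DifferentiableAt ℝ p x)
    (hQ : HasFDerivAt D Q x) (hD : D x = 0) :
    HasFDerivAt (fun y => a y • D y + (c y * ⟪p y, D y⟫_ℝ) • p y)
      (a x • Q + (c x • (innerSL ℝ (p x)).comp Q).smulRight (p x)) x := by
  refine ((ha.hasFDerivAt.smul hQ).add ((hc.hasFDerivAt.mul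
    (hp.hasFDerivAt.inner ℝ hQ)).smul hp.hasFDerivAt)).congr_fderiv ?_
  ext v
  simp [hD]

variable [CompleteSpace E]

theorem Cond24.hasDerivAt_deriv (hg : Cond24 g) {ξ : ℝ} (h : 0 < ξ) :
    HasDerivAt (deriv g) (deriv (deriv g) ξ) ξ := by
  have h2 : ContDiffAt ℝ 2 g ξ :=
    (hg.contDiffAt h).of_le (WithTop.coe_le_coe.2 (le_top : (2 : ℕ∞) ≤ ⊤))
  have h3 : ContDiffAt ℝ 1 (deriv g) ξ := by
    have := h2.fderiv_right (m := 1) (by norm_num)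
    exact this.clm_apply contDiffAt_const
  exact (h3.differentiableAt (by norm_num)).hasDerivAt

theorem Cond24.differentiableAt_Gfun (hg : Cond24 g) {ξ : ℝ} (h : 0 < ξ) :
    DifferentiableAt ℝ (Gfun g) ξ :=
  (hg.hasDerivAt h).differentiableAt.add
    ((differentiableAt_id.const_mul 2).mul (hg.hasDerivAt_deriv h).differentiableAt)

theorem Gfun_norm_sq {F : Type*} [NormedAddCommGroup F] (g : ℝ → ℝ) (p : F) :
    Gfun g (‖p‖ ^ 2) = g (‖p‖ ^ 2) + 2 * deriv g (‖p‖ ^ 2) * ‖p‖ ^ 2 := by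
  rw [Gfun]; ring

theorem eventually_regular (hu : ContDiffAt ℝ 3 u x) (hx : gradient u x ≠ 0) :
    ∀ᶠ y in nhds x, ContDiffAt ℝ 3 u y ∧ gradient u y ≠ 0 :=
  (hu.eventually (by norm_num)).and (hu.gradient.continuousAt.eventually_ne hx)

/-- The divergence of the vector flux in terms of the Hessian. -/
theorem sum_inner_fderiv_vflux {N : ℕ} (b : OrthonormalBasis (Fin N) ℝ E) (hg : Cond24 g)
    (hu : ContDiffAt ℝ 3 u x) (hx : gradient u x ≠ 0) :
    ∑ i, ⟪fderiv ℝ (vflux g u) x (b i), b i⟫_ℝ =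
      g (‖gradient u x‖ ^ 2) * ∑ i, ⟪fderiv ℝ (gradient u) x (b i), b i⟫_ℝ +
        2 * deriv g (‖gradient u x‖ ^ 2) *
          ⟪fderiv ℝ (gradient u) x (gradient u x), gradient u x⟫_ℝ := by
  simp only [fderiv_vflux_apply hg hu hx, inner_add_left, real_inner_smul_left,
    Finset.sum_add_distrib, ← Finset.mul_sum]
  congr 1
  rw [← b.sum_inner_mul_inner_apply, Finset.mul_sum]
  refine Finset.sum_congr rfl fun i _ => ?_
  rw [real_inner_comm (gradient u x) (fderiv ℝ (gradient u) x (b i))]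
  ring

/-- The `P`-function `∫₀^q s G(s²) ds - f(u)` with `f` strictly concave and suitable slope has no
interior local maximum. -/
theorem not_isLocalMax_pFunction {N : ℕ} (hN : 2 ≤ N) (b : OrthonormalBasis (Fin N) ℝ E)
    (hg : Cond24 g) (hu : ContDiffAt ℝ 3 u x) (hx : gradient u x ≠ 0)
    (hpde : ∀ᶠ y in nhds x, ∑ i, ⟪fderiv ℝ (vflux g u) y (b i), b i⟫_ℝ = N)
    {f f' : ℝ → ℝ} {f'' : ℝ} (hf : ∀ s, HasDerivAt f (f' s) s)
    (hf' : HasDerivAt f' f'' (u x)) (hf'' : f'' < 0)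
    (hβ : 0 ≤ (N - f' (u x)) * (1 - f' (u x))) :
    ¬ IsLocalMax (fun y => pot g (flux g ‖gradient u y‖) - f (u y)) x := by
  intro hmax
  have hreg := eventually_regular hu hx
  set p := gradient u x with hp
  set H := fderiv ℝ (gradient u) x with hH
  have hp0 : 0 < ‖p‖ := norm_pos_iff.2 hx
  have hp2 : 0 < ‖p‖ ^ 2 := by positivity
  have hgp : 0 < g (‖p‖ ^ 2) := hg.pos hp2
  have hGp : 0 < Gfun g (‖p‖ ^ 2) := hg.Gfun_pos hp2
  have hDu : DifferentiableAt ℝ (gradient u) x := hu.gradient.differentiableAt (by norm_num)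
  have hDDu : DifferentiableAt ℝ (fderiv ℝ (gradient u)) x :=
    (hu.gradient.fderiv_right (m := 1) (by norm_num)).differentiableAt (by norm_num)
  have hDu1 := hu.hasGradientAt_gradient.hasFDerivAt
  have hf'u := hf'.comp_hasFDerivAt x hDu1
  set D : E → E := fun y => Gfun g (‖gradient u y‖ ^ 2) • fderiv ℝ (gradient u) y (gradient u y)
    - f' (u y) • gradient u y with hD
  have hDgrad : ∀ᶠ y in nhds x, HasGradientAt
      (fun y => pot g (flux g ‖gradient u y‖) - f (u y)) (D y) y := by
    filter_upwards [hreg] with y hy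
    have h1 := (hasGradientAt_pot_flux hg hy.1 hy.2).hasFDerivAt
    have h2 := (hf (u y)).comp_hasFDerivAt y hy.1.hasGradientAt_gradient.hasFDerivAt
    rw [hasGradientAt_iff_hasFDerivAt]
    refine (h1.sub h2).congr_fderiv ?_
    ext v
    simp [hD]
  have hDx : D x = 0 := by
    have := hmax.hasFDerivAt_eq_zero hDgrad.self_of_nhds.hasFDerivAt
    simpa using this
  have hGd : DifferentiableAt ℝ (fun y => Gfun g (‖gradient u y‖ ^ 2)) x :=
    (hasFDerivAt_comp_norm_sq_gradient hu
      (hg.differentiableAt_Gfun hp2).hasDerivAt).differentiableAt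
  have hDd : DifferentiableAt ℝ D x :=
    (hGd.smul (hDDu.clm_apply hDu)).sub (hf'u.differentiableAt.smul hDu)
  set Q := fderiv ℝ D x
  have hQ := b.weighted_trace_nonpos
    (fun e => hmax.inner_fderiv_gradient_nonpos hDgrad hDd.hasFDerivAt e) (p := p) hgp.le
    (c := 2 * deriv g (‖p‖ ^ 2)) (by rw [← Gfun_norm_sq]; exact hGp.le)
  set Z := fderiv ℝ (vflux g u)
  have hzc : ContDiffAt ℝ 2 (vflux g u) x := contDiffAt_vflux hg hu hx
  have hZd : DifferentiableAt ℝ Z x :=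
    (hzc.fderiv_right (m := 1) (by norm_num)).differentiableAt (by norm_num)
  set X : E → E := fun y => Z y (gradient u y) - f' (u y) • gradient u y with hX
  have hXD : X =ᶠ[nhds x] fun y =>
      (g (‖gradient u y‖ ^ 2) / Gfun g (‖gradient u y‖ ^ 2)) • D y +
        (2 * deriv g (‖gradient u y‖ ^ 2) / Gfun g (‖gradient u y‖ ^ 2) *
          ⟪gradient u y, D y⟫_ℝ) • gradient u y := by
    filter_upwards [hreg] with y hy
    have hq : 0 < ‖gradient u y‖ ^ 2 := by have := norm_pos_iff.2 hy.2; positivity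
    have hG := hg.Gfun_pos hq
    simp only [hX, hD, Z, fderiv_vflux_apply hg hy.1 hy.2, inner_sub_right, real_inner_smul_right,
      real_inner_self_eq_norm_sq]
    set G := Gfun g (‖gradient u y‖ ^ 2) with hGdef
    have hg' : g (‖gradient u y‖ ^ 2) =
        G - 2 * deriv g (‖gradient u y‖ ^ 2) * ‖gradient u y‖ ^ 2 := by
      rw [hGdef, Gfun_norm_sq]; ring
    rw [hg']
    match_scalars <;> field_simp
    ring
  have hgd := (hasFDerivAt_comp_norm_sq_gradient hu (hg.hasDerivAt hp2)).differentiableAt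
  have hgd' : DifferentiableAt ℝ (fun y => 2 * deriv g (‖gradient u y‖ ^ 2)) x :=
    (hasFDerivAt_comp_norm_sq_gradient hu (hg.hasDerivAt_deriv hp2)).differentiableAt.const_mul 2
  have hgG : DifferentiableAt ℝ
      (fun y => g (‖gradient u y‖ ^ 2) / Gfun g (‖gradient u y‖ ^ 2)) x := by
    simp only [div_eq_mul_inv]
    exact hgd.mul (hGd.fun_inv hGp.ne')
  have hgG' : DifferentiableAt ℝ
      (fun y => 2 * deriv g (‖gradient u y‖ ^ 2) / Gfun g (‖gradient u y‖ ^ 2)) x := by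
    simp only [div_eq_mul_inv]
    exact hgd'.mul (hGd.fun_inv hGp.ne')
  have hX1 := hasFDerivAt_smul_add_inner_smul hgG hgG' hDu hDd.hasFDerivAt hDx
  have hX2 := (hZd.hasFDerivAt.clm_apply hDu.hasFDerivAt).sub (hf'u.smul hDu.hasFDerivAt)
  have hXeq := (hX1.congr_of_eventuallyEq hXD).unique hX2
  have htrace := congrArg (fun L : E →L[ℝ] E => ∑ i, ⟪L (b i), b i⟫_ℝ) hXeq
  set G := Gfun g (‖p‖ ^ 2) with hG
  have hl : ∑ i, ⟪((g (‖p‖ ^ 2) / G) • Q + ((2 * deriv g (‖p‖ ^ 2) / G) •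
      (innerSL ℝ p).comp Q).smulRight p) (b i), b i⟫_ℝ ≤ 0 := by
    have h1 : ∑ i, ⟪((g (‖p‖ ^ 2) / G) • Q + ((2 * deriv g (‖p‖ ^ 2) / G) •
        (innerSL ℝ p).comp Q).smulRight p) (b i), b i⟫_ℝ =
        (g (‖p‖ ^ 2) * ∑ i, ⟪Q (b i), b i⟫_ℝ + 2 * deriv g (‖p‖ ^ 2) * ⟪Q p, p⟫_ℝ) / G := by
      rw [← b.sum_inner_mul_inner_apply Q p p, Finset.mul_sum, Finset.mul_sum,
        ← Finset.sum_add_distrib, Finset.sum_div]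
      refine Finset.sum_congr rfl fun i _ => ?_
      simp only [add_apply, smul_apply, ContinuousLinearMap.smulRight_apply,
        ContinuousLinearMap.comp_apply, innerSL_apply_apply, inner_add_left, real_inner_smul_left,
        smul_eq_mul, real_inner_comm (Q (b i)) p]
      ring
    rw [h1]
    exact div_nonpos_of_nonpos_of_nonneg hQ hGp.le
  have hZconst : ∑ i, ⟪fderiv ℝ Z x (b i) p, b i⟫_ℝ = 0 := by
    have hsym : IsSymmSndFDerivAt ℝ (vflux g u) x := hzc.isSymmSndFDerivAt (by simp)
    have h1 : HasFDerivAt (fun y => ∑ i, ⟪Z y (b i), b i⟫_ℝ) (0 : E →L[ℝ] ℝ) x :=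
      (hasFDerivAt_const (N : ℝ) x).congr_of_eventuallyEq hpde
    have h2 := HasFDerivAt.fun_sum (u := Finset.univ) fun i _ =>
      (hZd.hasFDerivAt.clm_apply (hasFDerivAt_const (b i) x)).inner ℝ (hasFDerivAt_const (b i) x)
    have h3 := congrArg (fun L : E →L[ℝ] ℝ => L p) (h2.unique h1)
    simp only [sum_apply] at h3
    rw [zero_apply] at h3
    rw [← h3]
    refine Finset.sum_congr rfl fun i _ => ?_
    simp [hsym.eq (b i) p, Z]
  have hr : ∑ i, ⟪Z x (H (b i)), b i⟫_ℝ =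
      g (‖p‖ ^ 2) * ∑ i, ‖H (b i)‖ ^ 2 + 2 * deriv g (‖p‖ ^ 2) * ‖H p‖ ^ 2 := by
    rw [← real_inner_self_eq_norm_sq (H p), ← b.sum_inner_mul_inner_apply H p (H p), Finset.mul_sum,
      Finset.mul_sum, ← Finset.sum_add_distrib]
    refine Finset.sum_congr rfl fun i _ => ?_
    rw [fderiv_vflux_apply hg hu hx, inner_add_left, real_inner_smul_left, real_inner_smul_left,
      hu.inner_fderiv_gradient_comm (H (b i)), ← hu.inner_fderiv_gradient_comm (gradient u x),
      ← hp, ← hH, real_inner_self_eq_norm_sq, real_inner_comm (H p)]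
    ring
  have hmul := b.mul_trace_le (a := g (‖p‖ ^ 2)) (c := 2 * deriv g (‖p‖ ^ 2)) (H := H) hN
    hu.inner_fderiv_gradient_comm hx hgp (by rw [← Gfun_norm_sq]; exact hGp)
    (by rw [← Gfun_norm_sq, ← sub_eq_zero]; exact hDx)
    (by rw [← hpde.self_of_nhds, sum_inner_fderiv_vflux b hg hu hx]) hβ
  have hrhs : ∑ i, ⟪((Z x).comp H + (fderiv ℝ Z x).flip p - (f' (u x) • H +
      (f'' • InnerProductSpace.toDual ℝ E p).smulRight p)) (b i), b i⟫_ℝ =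
      g (‖p‖ ^ 2) * ∑ i, ‖H (b i)‖ ^ 2 + 2 * deriv g (‖p‖ ^ 2) * ‖H p‖ ^ 2 -
        f' (u x) * ∑ i, ⟪H (b i), b i⟫_ℝ - f'' * ‖p‖ ^ 2 := by
    rw [← hr, ← b.sum_inner_sq p, ← add_zero (∑ i, ⟪Z x (H (b i)), b i⟫_ℝ), ← hZconst,
      Finset.mul_sum, Finset.mul_sum, ← Finset.sum_add_distrib, ← Finset.sum_sub_distrib,
      ← Finset.sum_sub_distrib]
    refine Finset.sum_congr rfl fun i _ => ?_
    simp [inner_add_left, inner_sub_left, real_inner_smul_left]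
    ring
  have hneg : f'' * ‖p‖ ^ 2 < 0 := mul_neg_of_neg_of_pos hf'' hp2
  linarith [hrhs.ge.trans (htrace.ge.trans hl)]

end EquationP

section RadialComparison

open scoped InnerProductSpace

variable {E : Type*} [NormedAddCommGroup E] [InnerProductSpace ℝ E] {x o : E}

theorem hasFDerivAt_norm_sub (hx : x ≠ o) :
    HasFDerivAt (fun y => ‖y - o‖) (‖x - o‖⁻¹ • innerSL ℝ (x - o)) x := by
  have hr : 0 < ‖x - o‖ := norm_pos_iff.2 (sub_ne_zero.2 hx)
  have h1 := ((hasFDerivAt_id x).sub_const o).norm_sq.sqrt (by simpa using hr.ne')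
  simp only [id, Real.sqrt_sq (norm_nonneg _)] at h1
  refine h1.congr_fderiv ?_
  ext v
  simp
  field_simp

theorem hasGradientAt_radial [CompleteSpace E] {W : ℝ → ℝ} {W' : ℝ} (hx : x ≠ o)
    (hW : HasDerivAt W W' ‖x - o‖) :
    HasGradientAt (fun y => W ‖y - o‖) ((W' / ‖x - o‖) • (x - o)) x := by
  rw [hasGradientAt_iff_hasFDerivAt]
  refine (hW.comp_hasFDerivAt x (hasFDerivAt_norm_sub hx)).congr_fderiv ?_
  ext v
  simp
  ring

/-- Comparison of a solution with a radial function whose flux is `θ`: at an interior extremum of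
the difference the divergences of the fluxes are ordered. -/
theorem le_radial_divergence [CompleteSpace E] {N : ℕ} (b : OrthonormalBasis (Fin N) ℝ E)
    {g : ℝ → ℝ} {u : E → ℝ} (hg : Cond24 g) (hu : ContDiffAt ℝ 3 u x) (hx : gradient u x ≠ 0)
    (hpde : ∑ i, ⟪fderiv ℝ (vflux g u) x (b i), b i⟫_ℝ = N) (hxo : x ≠ o)
    {W θ : ℝ → ℝ} {θ' : ℝ} (hW : ∀ᶠ t in nhds ‖x - o‖, HasDerivAt W (fluxInv g (θ t)) t)
    (hθ : HasDerivAt θ θ' ‖x - o‖) (hθ0 : θ ‖x - o‖ ≠ 0) {k : ℝ} (hk : k ≠ 0)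
    (hmax : IsLocalMax (fun y => k * (u y - W ‖y - o‖)) x) :
    k * N ≤ k * (θ' + θ ‖x - o‖ * (N - 1) / ‖x - o‖) := by
  set r := ‖x - o‖ with hr
  have hr0 : 0 < r := norm_pos_iff.2 (sub_ne_zero.2 hxo)
  set m := fluxInv g (θ r) with hm
  have hm0 : 0 < m ^ 2 := by
    have : m ≠ 0 := fluxInv_ne_zero hg hθ0
    positivity
  have hgm : g (m ^ 2) * m = θ r := flux_fluxInv hg (θ r)
  have hG : 0 < Gfun g (m ^ 2) := hg.Gfun_pos hm0
  have hDu : DifferentiableAt ℝ (gradient u) x := hu.gradient.differentiableAt (by norm_num)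
  have hnorm : Tendsto (fun y : E => ‖y - o‖) (nhds x) (nhds r) :=
    (hasFDerivAt_norm_sub hxo).continuousAt
  set D : E → E := fun y => k • (gradient u y - (fluxInv g (θ ‖y - o‖) / ‖y - o‖) • (y - o))
  have hDgrad : ∀ᶠ y in nhds x, HasGradientAt (fun y => k * (u y - W ‖y - o‖)) (D y) y := by
    filter_upwards [eventually_regular hu hx, hnorm.eventually hW,
      eventually_ne_nhds hxo] with y hy hWy hyo
    have h1 := hy.1.hasGradientAt_gradient.hasFDerivAt.sub
      (hasGradientAt_radial hyo hWy).hasFDerivAt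
    rw [hasGradientAt_iff_hasFDerivAt]
    refine (h1.const_mul k).congr_fderiv ?_
    ext v
    simp [D]
  have hDx : D x = 0 := by
    simpa using hmax.hasFDerivAt_eq_zero hDgrad.self_of_nhds.hasFDerivAt
  have hp : gradient u x = (m / r) • (x - o) := by
    have := (smul_eq_zero.1 hDx).resolve_left hk
    exact sub_eq_zero.1 this
  have hpm : ‖gradient u x‖ ^ 2 = m ^ 2 := by
    rw [hp, norm_smul, mul_pow, Real.norm_eq_abs, sq_abs, ← hr]
    field_simp
  have hρ : HasDerivAt (fun t => fluxInv g (θ t) / t)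
      (((Gfun g (m ^ 2))⁻¹ * θ' * r - m * 1) / r ^ 2) r :=
    (HasDerivAt.comp r (hasDerivAt_fluxInv hg hθ0) hθ).div (hasDerivAt_id r) hr0.ne'
  set ρ' := ((Gfun g (m ^ 2))⁻¹ * θ' * r - m * 1) / r ^ 2 with hρ'
  have hQ := (hDu.hasFDerivAt.sub ((hρ.comp_hasFDerivAt x (hasFDerivAt_norm_sub hxo)).smul
    ((hasFDerivAt_id x).sub_const o))).const_smul k
  set H := fderiv ℝ (gradient u) x
  set Q := k • (H - ((m / r) • ContinuousLinearMap.id ℝ E +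
    (ρ' • r⁻¹ • innerSL ℝ (x - o)).smulRight (x - o))) with hQdef
  have hQ' : HasFDerivAt D Q x := hQ
  have htr := b.weighted_trace_nonpos
    (fun e => hmax.inner_fderiv_gradient_nonpos hDgrad hQ' e) (p := gradient u x)
    (a := g (m ^ 2)) (c := 2 * deriv g (m ^ 2)) (hg.pos hm0).le
    (by rw [← hpm, ← Gfun_norm_sq, hpm]; exact hG.le)
  have hsum : ∑ i, ⟪Q (b i), b i⟫_ℝ =
      k * (∑ i, ⟪H (b i), b i⟫_ℝ - (N * (m / r) + ρ' * r)) := by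
    have h1 : ρ' * r = ρ' * r⁻¹ * ∑ i, ⟪x - o, b i⟫_ℝ ^ 2 := by
      rw [b.sum_inner_sq, ← hr]; field_simp
    have h2 : N * (m / r) = ∑ i : Fin N, m / r := by simp
    rw [h1, h2, Finset.mul_sum, ← Finset.sum_add_distrib, ← Finset.sum_sub_distrib,
      Finset.mul_sum]
    refine Finset.sum_congr rfl fun i _ => ?_
    have hb : ⟪b i, b i⟫_ℝ = 1 := by simp
    simp only [hQdef, smul_apply, sub_apply, add_apply, ContinuousLinearMap.smulRight_apply,
      ContinuousLinearMap.id_apply, innerSL_apply_apply, smul_eq_mul, inner_sub_left (𝕜 := ℝ)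
      (H (b i)), inner_add_left, real_inner_smul_left, hb]
    ring
  have hpp : ⟪Q (gradient u x), gradient u x⟫_ℝ =
      k * (⟪H (gradient u x), gradient u x⟫_ℝ - m ^ 2 * (m / r + ρ' * r)) := by
    have h1 : ⟪x - o, gradient u x⟫_ℝ = m * r := by
      rw [hp, real_inner_smul_right, real_inner_self_eq_norm_sq, ← hr]; field_simp
    simp only [hQdef, smul_apply, sub_apply, add_apply, ContinuousLinearMap.smulRight_apply,
      ContinuousLinearMap.id_apply, innerSL_apply_apply, smul_eq_mul, inner_sub_left (𝕜 := ℝ)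
      (H _), inner_add_left, real_inner_smul_left, h1, real_inner_self_eq_norm_sq, hpm]
    field_simp
  have hdiv := sum_inner_fderiv_vflux b hg hu hx
  rw [hpde, hpm] at hdiv
  rw [hsum, hpp] at htr
  have hkey : g (m ^ 2) * (N * (m / r) + ρ' * r) + 2 * deriv g (m ^ 2) *
      (m ^ 2 * (m / r + ρ' * r)) = θ' + θ r * (N - 1) / r := by
    have h1 : m / r + ρ' * r = θ' / Gfun g (m ^ 2) := by rw [hρ']; field_simp; ring
    have h2 : Gfun g (m ^ 2) * (θ' / Gfun g (m ^ 2)) = θ' := by field_simp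
    rw [← h1, Gfun] at h2
    rw [← hgm]
    linear_combination h2
  rw [← hkey]
  linear_combination htr + k * hdiv

end RadialComparison

section RingDomain

open scoped InnerProductSpace

variable {E : Type*} [NormedAddCommGroup E] [InnerProductSpace ℝ E]

theorem OrthonormalBasis.properSpace {ι : Type*} [Fintype ι] (b : OrthonormalBasis ι ℝ E) :
    ProperSpace E :=
  have := b.toBasis.finiteDimensional_of_finite
  FiniteDimensional.proper ℝ E

/-- The overdetermined problem on the ring-shaped domain `Ω₀ \ closure Ω₁`. -/
structure IsRingSolution [CompleteSpace E] {N : ℕ} (b : OrthonormalBasis (Fin N) ℝ E) (g : ℝ → ℝ)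
    (Ω₀ Ω₁ : Set E) (q₀ c₁ : ℝ) (u : E → ℝ) : Prop where
  two_le : 2 ≤ N
  cond : Cond24 g
  isOpen_outer : IsOpen Ω₀
  isOpen_inner : IsOpen Ω₁
  isBounded_outer : Bornology.IsBounded Ω₀
  convex_outer : Convex ℝ Ω₀
  convex_inner : Convex ℝ Ω₁
  nonempty_inner : Ω₁.Nonempty
  closure_subset : closure Ω₁ ⊆ Ω₀
  q_pos : 0 < q₀
  c_pos : 0 < c₁
  contDiffAt : ∀ x ∈ closure (Ω₀ \ closure Ω₁), ContDiffAt ℝ 3 u x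
  gradient_ne : ∀ x ∈ Ω₀ \ closure Ω₁, gradient u x ≠ 0
  div_eq : ∀ x ∈ Ω₀ \ closure Ω₁, ∑ i, ⟪fderiv ℝ (vflux g u) x (b i), b i⟫_ℝ = N
  eq_outer : ∀ x ∈ frontier Ω₀, u x = 0
  norm_gradient_outer : ∀ x ∈ frontier Ω₀, ‖gradient u x‖ = q₀
  eq_inner : ∀ x ∈ frontier Ω₁, u x = -c₁
  gradient_inner : ∀ x ∈ frontier Ω₁, gradient u x = 0

namespace IsRingSolution

variable [CompleteSpace E] {N : ℕ} {b : OrthonormalBasis (Fin N) ℝ E} {g : ℝ → ℝ} {Ω₀ Ω₁ : Set E}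
  {q₀ c₁ : ℝ} {u : E → ℝ}

theorem isOpen_ring (h : IsRingSolution b g Ω₀ Ω₁ q₀ c₁ u) : IsOpen (Ω₀ \ closure Ω₁) :=
  h.isOpen_outer.sdiff isClosed_closure

theorem isCompact_closure (h : IsRingSolution b g Ω₀ Ω₁ q₀ c₁ u) :
    IsCompact (closure (Ω₀ \ closure Ω₁)) :=
  have := b.properSpace
  (h.isBounded_outer.subset sdiff_subset).isCompact_closure

theorem notMem_inner (h : IsRingSolution b g Ω₀ Ω₁ q₀ c₁ u) {x : E}
    (hx : x ∈ closure (Ω₀ \ closure Ω₁)) : x ∉ Ω₁ := by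
  have h1 : closure (Ω₀ \ closure Ω₁) ⊆ Ω₁ᶜ :=
    closure_minimal (fun y hy hy1 => hy.2 (subset_closure hy1)) h.isOpen_inner.isClosed_compl
  exact h1 hx

theorem mem_frontier_or (h : IsRingSolution b g Ω₀ Ω₁ q₀ c₁ u) {x : E}
    (hx : x ∈ closure (Ω₀ \ closure Ω₁)) (hx' : x ∉ Ω₀ \ closure Ω₁) :
    x ∈ frontier Ω₀ ∨ x ∈ frontier Ω₁ := by
  rw [h.isOpen_outer.frontier_eq, h.isOpen_inner.frontier_eq]
  by_cases hx0 : x ∈ Ω₀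
  · exact Or.inr ⟨by_contra fun hc => hx' ⟨hx0, hc⟩, h.notMem_inner hx⟩
  · exact Or.inl ⟨closure_mono sdiff_subset hx, hx0⟩

theorem frontier_outer_subset (h : IsRingSolution b g Ω₀ Ω₁ q₀ c₁ u) :
    frontier Ω₀ ⊆ closure (Ω₀ \ closure Ω₁) := by
  rw [h.isOpen_outer.frontier_eq]
  rintro x ⟨hx, hx0⟩
  have := (isClosed_closure (s := Ω₁)).isOpen_compl.inter_closure
    ⟨fun hc => hx0 (h.closure_subset hc), hx⟩
  rwa [inter_comm] at this

theorem frontier_inner_subset (h : IsRingSolution b g Ω₀ Ω₁ q₀ c₁ u) :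
    frontier Ω₁ ⊆ closure (Ω₀ \ closure Ω₁) := by
  intro x hx
  rw [h.isOpen_inner.frontier_eq] at hx
  have hint : interior (closure Ω₁) = Ω₁ := by
    rw [h.convex_inner.interior_closure_eq_interior_of_nonempty_interior,
      h.isOpen_inner.interior_eq]
    rw [h.isOpen_inner.interior_eq]
    exact h.nonempty_inner
  have h1 : x ∈ closure (closure Ω₁)ᶜ := by
    rw [closure_compl, hint]
    exact hx.2
  exact h.isOpen_outer.inter_closure ⟨h.closure_subset hx.1, h1⟩

theorem continuousOn (h : IsRingSolution b g Ω₀ Ω₁ q₀ c₁ u) :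
    ContinuousOn u (closure (Ω₀ \ closure Ω₁)) :=
  fun x hx => (h.contDiffAt x hx).continuousAt.continuousWithinAt

theorem continuousOn_gradient (h : IsRingSolution b g Ω₀ Ω₁ q₀ c₁ u) :
    ContinuousOn (gradient u) (closure (Ω₀ \ closure Ω₁)) :=
  fun x hx => (h.contDiffAt x hx).gradient.continuousAt.continuousWithinAt

theorem eventually_div_eq (h : IsRingSolution b g Ω₀ Ω₁ q₀ c₁ u) {x : E}
    (hx : x ∈ Ω₀ \ closure Ω₁) :
    ∀ᶠ y in nhds x, ∑ i, ⟪fderiv ℝ (vflux g u) y (b i), b i⟫_ℝ = N :=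
  eventually_of_mem (h.isOpen_ring.mem_nhds hx) h.div_eq

theorem le_of_forall_not_isLocalMax (h : IsRingSolution b g Ω₀ Ω₁ q₀ c₁ u) {F : E → ℝ} {M : ℝ}
    (hF : ContinuousOn F (closure (Ω₀ \ closure Ω₁)))
    (hmax : ∀ x ∈ Ω₀ \ closure Ω₁, ¬ IsLocalMax F x) (h0 : ∀ x ∈ frontier Ω₀, F x ≤ M)
    (h1 : ∀ x ∈ frontier Ω₁, F x ≤ M) {x : E} (hx : x ∈ closure (Ω₀ \ closure Ω₁)) : F x ≤ M := by
  obtain ⟨z, hz, hzmax⟩ := h.isCompact_closure.exists_isMaxOn ⟨x, hx⟩ hF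
  refine (hzmax hx).trans ?_
  by_cases hz' : z ∈ Ω₀ \ closure Ω₁
  · exact absurd (hzmax.isLocalMax (mem_of_superset (h.isOpen_ring.mem_nhds hz') subset_closure))
      (hmax z hz')
  · exact (h.mem_frontier_or hz hz').elim (h0 z) (h1 z)

theorem fderiv_ne (h : IsRingSolution b g Ω₀ Ω₁ q₀ c₁ u) {x : E} (hx : x ∈ Ω₀ \ closure Ω₁) :
    fderiv ℝ u x ≠ 0 := fun hc => h.gradient_ne x hx (by simp [gradient, hc])

theorem nonpos (h : IsRingSolution b g Ω₀ Ω₁ q₀ c₁ u) {x : E}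
    (hx : x ∈ closure (Ω₀ \ closure Ω₁)) : u x ≤ 0 :=
  h.le_of_forall_not_isLocalMax h.continuousOn
    (fun _ hy hmax => h.fderiv_ne hy hmax.fderiv_eq_zero) (fun y hy => (h.eq_outer y hy).le)
    (fun y hy => by rw [h.eq_inner y hy]; linarith [h.c_pos]) hx

theorem neg_le (h : IsRingSolution b g Ω₀ Ω₁ q₀ c₁ u) {x : E}
    (hx : x ∈ closure (Ω₀ \ closure Ω₁)) : -c₁ ≤ u x := by
  have := h.le_of_forall_not_isLocalMax (F := fun y => -u y) (M := c₁) h.continuousOn.neg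
    (fun y hy hmax => h.fderiv_ne hy (by simpa using hmax.neg.fderiv_eq_zero))
    (fun y hy => by simp [h.eq_outer y hy, h.c_pos.le]) (fun y hy => by simp [h.eq_inner y hy]) hx
  linarith

theorem neg_lt (h : IsRingSolution b g Ω₀ Ω₁ q₀ c₁ u) {x : E} (hx : x ∈ Ω₀ \ closure Ω₁) :
    -c₁ < u x := by
  refine (h.neg_le (subset_closure hx)).lt_of_ne fun hc => ?_
  have hmin : IsLocalMin u x := by
    filter_upwards [h.isOpen_ring.mem_nhds hx] with y hy
    rw [← hc]
    exact h.neg_le (subset_closure hy)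
  exact h.fderiv_ne hx hmin.fderiv_eq_zero

/-- The maximum principle for the `P`-functions with slope `1` or `N`. -/
theorem pot_flux_le (h : IsRingSolution b g Ω₀ Ω₁ q₀ c₁ u) {α M : ℝ} (hα : α = 1 ∨ α = N)
    (h0 : pot g (flux g q₀) ≤ M) (h1 : α * c₁ ≤ M) {x : E}
    (hx : x ∈ closure (Ω₀ \ closure Ω₁)) :
    pot g (flux g ‖gradient u x‖) ≤ M + α * u x := by
  have hN : (2 : ℝ) ≤ N := by exact_mod_cast h.two_le
  obtain ⟨a, ha⟩ : ∃ a : ℝ, ∀ s, -c₁ ≤ s → s ≤ 0 → ∀ ε, 0 < ε →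
      0 ≤ (N - (α - 2 * ε * (s - a))) * (1 - (α - 2 * ε * (s - a))) := by
    rcases hα with rfl | rfl
    · refine ⟨-c₁ - 1, fun s hs _ ε hε => ?_⟩
      have : 0 < 2 * ε * (s - (-c₁ - 1)) := mul_pos (by linarith) (by linarith)
      exact mul_nonneg (by linarith) (by linarith)
    · refine ⟨1, fun s _ hs ε hε => ?_⟩
      have : 2 * ε * (s - 1) < 0 := mul_neg_of_pos_of_neg (by linarith) (by linarith)
      exact mul_nonneg_of_nonpos_of_nonpos (by linarith) (by linarith)
  have key : ∀ ε > 0, pot g (flux g ‖gradient u x‖) ≤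
      M + α * u x + ε * (a ^ 2 + (c₁ + a) ^ 2) := fun ε hε => by
    have hle := h.le_of_forall_not_isLocalMax
      (F := fun y => pot g (flux g ‖gradient u y‖) - (α * u y - ε * (u y - a) ^ 2))
      (M := M + ε * (a ^ 2 + (c₁ + a) ^ 2)) ?_ ?_ ?_ ?_ hx
    · nlinarith [sq_nonneg (u x - a)]
    · exact ((continuous_pot h.cond).comp_continuousOn ((continuous_flux h.cond).comp_continuousOn
        h.continuousOn_gradient.norm)).sub ((h.continuousOn.const_smul α).sub
          (((h.continuousOn.sub continuousOn_const).pow 2).const_smul ε))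
    · intro y hy
      have hyc := subset_closure hy
      refine not_isLocalMax_pFunction h.two_le b h.cond (h.contDiffAt y hyc) (h.gradient_ne y hy)
        (h.eventually_div_eq hy) (f := fun s => α * s - ε * (s - a) ^ 2)
        (f' := fun s => α - 2 * ε * (s - a)) (f'' := -(2 * ε)) (fun s => ?_) ?_ (by linarith)
        (ha _ (h.neg_le hyc) (h.nonpos hyc) ε hε)
      · refine (((hasDerivAt_id s).const_mul α).sub
          ((((hasDerivAt_id s).sub_const a).pow 2).const_mul ε)).congr_deriv ?_
        simp
        ring
      · refine ((((hasDerivAt_id (u y)).sub_const a).const_mul (2 * ε)).const_sub α).congr_deriv ?_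
        simp
    · intro y hy
      simp only [h.eq_outer y hy, h.norm_gradient_outer y hy]
      nlinarith [mul_nonneg hε.le (sq_nonneg (c₁ + a))]
    · intro y hy
      simp only [h.eq_inner y hy, h.gradient_inner y hy, norm_zero, flux_zero, pot_zero]
      nlinarith [mul_nonneg hε.le (sq_nonneg a)]
  refine le_of_forall_pos_le_add fun δ hδ =>
    (key (δ / (a ^ 2 + (c₁ + a) ^ 2 + 1)) (by positivity)).trans ?_
  gcongr
  rw [div_mul_eq_mul_div, div_le_iff₀ (by positivity)]
  nlinarith

end IsRingSolution

end RingDomain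

section Segments

open scoped InnerProductSpace

variable {E : Type*} [NormedAddCommGroup E]

/-- Growth of a function along a segment on which its gradient is controlled by its value. -/
theorem add_mul_le_pot_of_segment [InnerProductSpace ℝ E] [CompleteSpace E] {g : ℝ → ℝ}
    (hg : Cond24 g) {u : E → ℝ} {y z : E} {α M m : ℝ} (hα : 0 ≤ α) (hm : 0 ≤ m)
    (hu : ∀ w ∈ segment ℝ y z, DifferentiableAt ℝ u w)
    (hP : ∀ w ∈ segment ℝ y z, pot g (flux g ‖gradient u w‖) ≤ M + α * u w)
    (hy : M + α * u y ≤ pot g m) : M + α * u z ≤ pot g (m + α * ‖z - y‖) := by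
  have key : ∀ δ > 0, M + α * u z ≤ pot g (m + α * ‖z - y‖ + 2 * δ) := fun δ hδ => by
    set B' : ℝ → ℝ := fun t => fluxInv g (m + δ + (α * ‖z - y‖ + δ) * t) * (α * ‖z - y‖ + δ)
    have hB : ∀ t, HasDerivAt (fun t => pot g (m + δ + (α * ‖z - y‖ + δ) * t)) (B' t) t :=
      fun t => by
        have h1 := ((hasDerivAt_id t).const_mul (α * ‖z - y‖ + δ)).const_add (m + δ)
        simp only [id, mul_one] at h1
        exact (hasDerivAt_pot hg _).comp t h1
    have hseg : ∀ t ∈ Icc (0 : ℝ) 1, AffineMap.lineMap y z t ∈ segment ℝ y z := fun t ht => by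
      rw [segment_eq_image_lineMap]; exact ⟨t, ht, rfl⟩
    have hf : ∀ t ∈ Icc (0 : ℝ) 1, HasDerivAt (fun t => M + α * u (AffineMap.lineMap y z t))
        (α * ⟪gradient u (AffineMap.lineMap y z t), z - y⟫_ℝ) t := fun t ht => by
      have h1 := (hu _ (hseg t ht)).hasFDerivAt.comp_hasDerivAt t AffineMap.hasDerivAt_lineMap
      rw [inner_gradient_eq_fderiv]
      exact (h1.const_mul α).const_add M
    have hend := image_le_of_deriv_right_lt_deriv_boundary
      (fun t ht => (hf t ht).continuousAt.continuousWithinAt)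
      (fun t ht => (hf t (Ico_subset_Icc_self ht)).hasDerivWithinAt) (B' := B') ?_ hB ?_
      (right_mem_Icc.2 zero_le_one)
    · simp only [AffineMap.lineMap_apply_one] at hend
      convert hend using 2
      ring
    · simp only [AffineMap.lineMap_apply_zero, mul_zero, add_zero]
      exact hy.trans ((strictMonoOn_pot hg).monotoneOn hm (by simp; positivity) (by linarith))
    · intro t ht heq
      set w := AffineMap.lineMap y z t
      set s := m + δ + (α * ‖z - y‖ + δ) * t
      have hs : 0 < s := by have := ht.1; positivity
      have hle : pot g (flux g ‖gradient u w‖) ≤ pot g s :=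
        (hP w (hseg t (Ico_subset_Icc_self ht))).trans_eq heq
      have h0 : 0 ≤ flux g ‖gradient u w‖ := by
        rw [← flux_zero g]; exact (strictMono_flux hg).monotone (norm_nonneg _)
      have h1 : flux g ‖gradient u w‖ ≤ s :=
        ((strictMonoOn_pot hg).le_iff_le h0 hs.le).1 hle
      have h2 : ‖gradient u w‖ ≤ fluxInv g s := by
        rw [← fluxInv_flux hg ‖gradient u w‖]
        exact (strictMono_fluxInv hg).monotone h1
      have hs' := fluxInv_pos hg hs
      calc α * ⟪gradient u w, z - y⟫_ℝ ≤ α * (fluxInv g s * ‖z - y‖) := by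
            gcongr
            exact (real_inner_le_norm _ _).trans (by gcongr)
        _ < fluxInv g s * (α * ‖z - y‖ + δ) := by nlinarith
  have hlim : Tendsto (fun δ : ℝ => pot g (m + α * ‖z - y‖ + 2 * δ)) (nhdsWithin 0 (Ioi 0))
      (nhds (pot g (m + α * ‖z - y‖))) := by
    have hc : Continuous (fun δ : ℝ => pot g (m + α * ‖z - y‖ + 2 * δ)) :=
      (continuous_pot hg).comp (by fun_prop)
    simpa using (hc.tendsto 0).mono_left nhdsWithin_le_nhds
  exact ge_of_tendsto hlim (eventually_mem_nhdsWithin.mono key)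

/-- The last point of a closed set on a segment leaving the set. -/
theorem exists_mem_frontier_segment [NormedSpace ℝ E] {C : Set E} (hC : IsClosed C) {y x : E}
    (hy : y ∈ C) (hx : x ∉ C) :
    ∃ z ∈ segment ℝ y x, z ∈ frontier C ∧ ∀ w ∈ segment ℝ z x, w ≠ z → w ∉ C := by
  have hcomp : IsCompact (segment ℝ y x) := by
    rw [segment_eq_image_lineMap]
    exact isCompact_Icc.image AffineMap.lineMap_continuous
  obtain ⟨z, ⟨hzs, hzC⟩, hzmin⟩ := (hcomp.inter_right hC).exists_isMinOn
    ⟨y, left_mem_segment ℝ y x, hy⟩ (f := fun w => dist w x) (by fun_prop)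
  have hsub : segment ℝ z x ⊆ segment ℝ y x :=
    (convex_segment y x).segment_subset hzs (right_mem_segment ℝ y x)
  have hlast : ∀ w ∈ segment ℝ z x, w ≠ z → w ∉ C := fun w hw hwz hwC => by
    have h1 : dist z x ≤ dist w x := hzmin ⟨hsub hw, hwC⟩
    have h2 := dist_add_dist_of_mem_segment hw
    exact hwz (dist_le_zero.1 (by rw [dist_comm]; linarith))
  refine ⟨z, hzs, ?_, hlast⟩
  rw [hC.frontier_eq]
  refine ⟨hzC, fun hint => ?_⟩
  have hzx : z ≠ x := fun h => hx (h ▸ hzC)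
  have hlim : Tendsto (AffineMap.lineMap z x : ℝ → E) (nhdsWithin 0 (Ioi 0)) (nhds z) := by
    have := (AffineMap.lineMap_continuous (p := z) (q := x) (R := ℝ)).tendsto 0
    rw [AffineMap.lineMap_apply_zero] at this
    exact this.mono_left nhdsWithin_le_nhds
  have hev := hlim.eventually (mem_interior_iff_mem_nhds.1 hint)
  obtain ⟨t, htC, ht⟩ := (hev.and (Ioo_mem_nhdsGT (zero_lt_one' ℝ))).exists
  refine hlast _ ?_ ?_ htC
  · rw [segment_eq_image_lineMap]; exact ⟨t, Ioo_subset_Icc_self ht, rfl⟩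
  · rw [ne_eq, AffineMap.lineMap_eq_left_iff]
    exact not_or.2 ⟨hzx, ht.1.ne'⟩

end Segments

section Bounds

open scoped InnerProductSpace

theorem pot_nonneg {g : ℝ → ℝ} (hg : Cond24 g) (t : ℝ) : 0 ≤ pot g t := by
  rcases le_total 0 t with ht | ht
  · rw [← pot_zero g]
    exact (strictMonoOn_pot hg).monotoneOn self_mem_Ici ht ht
  · rw [← pot_zero g]
    refine antitoneOn_of_deriv_nonpos (convex_Iic 0) (continuous_pot hg).continuousOn
      (fun s _ => (hasDerivAt_pot hg s).differentiableAt.differentiableWithinAt) (fun s hs => ?_)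
      ht self_mem_Iic ht
    rw [interior_Iic] at hs
    rw [(hasDerivAt_pot hg s).deriv, ← fluxInv_zero hg]
    exact (strictMono_fluxInv hg).monotone hs.le

theorem pot_lt_pot_mul_div {g : ℝ → ℝ} (hg : Cond24 g) {κ ρ : ℝ} (hκ : 1 < κ) (hρ : 0 < ρ) :
    pot g ρ < pot g (κ * ρ) / κ := by
  have hκ0 : 0 < κ := by linarith
  have h1 := (strictConvexOn_pot hg).2 (mem_univ (κ * ρ)) (mem_univ 0) (by positivity)
    (inv_pos.2 hκ0) (sub_pos.2 (inv_lt_one_of_one_lt₀ hκ)) (by ring)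
  simp only [smul_eq_mul, pot_zero, mul_zero, add_zero] at h1
  rwa [inv_mul_cancel_left₀ hκ0.ne', inv_mul_eq_div] at h1

namespace IsRingSolution

variable {E : Type*} [NormedAddCommGroup E] [InnerProductSpace ℝ E] [CompleteSpace E] {N : ℕ}
  {b : OrthonormalBasis (Fin N) ℝ E} {g : ℝ → ℝ} {Ω₀ Ω₁ : Set E} {q₀ c₁ : ℝ} {u : E → ℝ}

theorem nontrivial (h : IsRingSolution b g Ω₀ Ω₁ q₀ c₁ u) : Nontrivial E :=
  ⟨b ⟨0, by linarith [h.two_le]⟩, 0, b.orthonormal.ne_zero _⟩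

theorem exists_nearest (h : IsRingSolution b g Ω₀ Ω₁ q₀ c₁ u) {y : E} (hy : y ∈ Ω₁) :
    ∃ x ∈ frontier Ω₁, 0 < dist y x ∧ Metric.ball y (dist y x) ⊆ Ω₁ ∧
      Metric.closedBall y (dist y x) ⊆ closure Ω₁ := by
  have := h.nontrivial
  have := b.properSpace
  have hne : (Ω₁ᶜ).Nonempty := by
    rw [nonempty_compl]
    rintro rfl
    refine NormedSpace.unbounded_univ ℝ E (h.isBounded_outer.subset fun z _ => ?_)
    exact h.closure_subset (subset_closure (mem_univ z))
  obtain ⟨x, hx, hdist⟩ := h.isOpen_inner.isClosed_compl.exists_infDist_eq_dist hne y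
  have hpos : 0 < dist y x := dist_pos.2 fun he => hx (he ▸ hy)
  have hball : Metric.ball y (dist y x) ⊆ Ω₁ := fun z hz => by
    by_contra hz1
    have := Metric.infDist_le_dist_of_mem (x := y) (s := Ω₁ᶜ) hz1
    rw [hdist, dist_comm y z] at this
    exact absurd (Metric.mem_ball.1 hz) this.not_gt
  have hcball : Metric.closedBall y (dist y x) ⊆ closure Ω₁ := by
    rw [← closure_ball y hpos.ne']
    exact closure_mono hball
  refine ⟨x, ?_, hpos, hball, hcball⟩
  rw [h.isOpen_inner.frontier_eq]
  exact ⟨hcball (by simp [dist_comm]), hx⟩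

/-- Distance estimate from the inner boundary when the `P`-function with slope `1` is bounded by
`c₁`. -/
theorem add_le_pot_of_segment (h : IsRingSolution b g Ω₀ Ω₁ q₀ c₁ u)
    (hP : ∀ x ∈ closure (Ω₀ \ closure Ω₁), pot g (flux g ‖gradient u x‖) ≤ c₁ + 1 * u x)
    {y z : E} {r t : ℝ} (hy : y ∈ Ω₁) (hz : z ∈ Ω₀ \ closure Ω₁)
    (hball : Metric.ball y r ⊆ Ω₁) (hd : dist y z ≤ r + t) : c₁ + u z ≤ pot g t := by
  obtain ⟨w, hw, hwf, hwz⟩ := exists_mem_frontier_segment isClosed_closure (subset_closure hy) hz.2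
  have hwf' : w ∈ frontier Ω₁ := frontier_closure_subset hwf
  have hw0 : w ∈ Ω₀ := h.closure_subset (frontier_subset_closure hwf')
  have hseg : segment ℝ w z ⊆ closure (Ω₀ \ closure Ω₁) := fun p hp => by
    by_cases hpw : p = w
    · rw [hpw]; exact h.frontier_inner_subset hwf'
    · exact subset_closure ⟨h.convex_outer.segment_subset hw0 hz.1 hp, hwz p hp hpw⟩
  have hle := add_mul_le_pot_of_segment h.cond zero_le_one le_rfl
    (fun p hp => (h.contDiffAt p (hseg hp)).differentiableAt (by norm_num))
    (fun p hp => hP p (hseg hp)) (by rw [h.eq_inner w hwf', pot_zero]; simp)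
  rw [one_mul, zero_add, one_mul] at hle
  have hwr : r ≤ dist y w := by
    by_contra! hlt
    rw [h.isOpen_inner.frontier_eq] at hwf'
    exact hwf'.2 (hball (by rwa [Metric.mem_ball, dist_comm]))
  have hsum := dist_add_dist_of_mem_segment hw
  have hlen : ‖z - w‖ ≤ t := by rw [← dist_eq_norm, dist_comm]; linarith
  exact hle.trans ((strictMonoOn_pot h.cond).monotoneOn (norm_nonneg _)
    ((norm_nonneg _).trans hlen) hlen)

theorem lt_pot_flux (h : IsRingSolution b g Ω₀ Ω₁ q₀ c₁ u) : c₁ < pot g (flux g q₀) := by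
  by_contra! hle
  have hg := h.cond
  have hN : (2 : ℝ) ≤ N := by exact_mod_cast h.two_le
  have hP : ∀ x ∈ closure (Ω₀ \ closure Ω₁), pot g (flux g ‖gradient u x‖) ≤ c₁ + 1 * u x :=
    fun x hx => h.pot_flux_le (Or.inl rfl) hle (one_mul c₁).le hx
  have := b.properSpace
  obtain ⟨y, hy⟩ := h.nonempty_inner
  obtain ⟨x₁, hx₁, hr, hball, hcball⟩ := h.exists_nearest hy
  set r := dist y x₁ with hr_def
  obtain ⟨δ, hδ, hδsub⟩ := (isCompact_closedBall y r).exists_cthickening_subset_open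
    h.isOpen_outer (hcball.trans h.closure_subset)
  rw [cthickening_closedBall hδ.le hr.le] at hδsub
  obtain ⟨ρ, hρ, hρδ, hρr⟩ : ∃ ρ > 0, 2 * ρ ≤ δ ∧ ρ * (4 * N) ≤ r := by
    refine ⟨min (δ / 2) (r / (4 * N)), by positivity, ?_, ?_⟩
    · linarith [min_le_left (δ / 2) (r / (4 * N))]
    · rw [← le_div_iff₀ (by positivity)]
      exact min_le_right _ _
  set κ : ℝ := 3 / 2 with hκ
  obtain ⟨ε, hε, hερ, hεr, hεV⟩ : ∃ ε > 0, ε ≤ ρ ∧ ε < r ∧ pot g (ρ + ε) < pot g (κ * ρ) / κ := by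
    have hc : Continuous fun ε => pot g (ρ + ε) := (continuous_pot hg).comp (by fun_prop)
    have h1 : ∀ᶠ ε in nhds (0 : ℝ), pot g (ρ + ε) < pot g (κ * ρ) / κ := by
      refine (hc.tendsto 0).eventually (gt_mem_nhds ?_)
      rw [add_zero]
      exact pot_lt_pot_mul_div hg (by norm_num [hκ]) hρ
    have h2 : ∀ᶠ ε in nhdsWithin (0 : ℝ) (Ioi 0), pot g (ρ + ε) < pot g (κ * ρ) / κ :=
      h1.filter_mono nhdsWithin_le_nhds
    obtain ⟨ε, hε1, hε2⟩ := (h2.and (Ioo_mem_nhdsGT (lt_min hρ hr))).exists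
    exact ⟨ε, hε2.1, (hε2.2.trans_le (min_le_left _ _)).le, hε2.2.trans_le (min_le_right _ _), hε1⟩
  obtain ⟨xε, hxε, hxεd⟩ := Metric.mem_closure_iff.1 (h.frontier_inner_subset hx₁) ε hε
  set o := y + (xε - x₁) with ho
  have hoy : dist y o < ε := by
    rw [dist_eq_norm, ho, sub_add_cancel_left, neg_sub, ← dist_eq_norm]; exact hxεd
  have hxo : ‖xε - o‖ = r := by
    rw [ho, hr_def, dist_comm, dist_eq_norm]; congr 1; abel
  have hoball : Metric.ball o (r - ε) ⊆ Ω₁ :=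
    (Metric.ball_subset_ball' (by rw [dist_comm]; linarith)).trans hball
  have ho1 : o ∈ Ω₁ := hball (by rw [Metric.mem_ball, dist_comm]; linarith)
  set W : ℝ → ℝ := fun t => pot g (κ * (t - r)) / κ
  have hW0 : ∀ t, 0 ≤ W t := fun t => div_nonneg (pot_nonneg hg _) (by norm_num [hκ])
  have hWd : ∀ t, HasDerivAt W (fluxInv g (κ * (t - r))) t := fun t => by
    have h1 := (hasDerivAt_pot hg (κ * (t - r))).comp t
      (((hasDerivAt_id t).sub_const r).const_mul κ)
    refine (h1.div_const κ).congr_deriv ?_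
    field_simp
  set F : E → ℝ := fun x => u x - W ‖x - o‖
  have hF : ContinuousOn F (closure (Ω₀ \ closure Ω₁) ∩ Metric.closedBall o (r + ρ)) := by
    have hWc : Continuous W := continuous_iff_continuousAt.2 fun t => (hWd t).continuousAt
    exact (h.continuousOn.mono inter_subset_left).sub (hWc.comp (by fun_prop)).continuousOn
  have hxεK : xε ∈ closure (Ω₀ \ closure Ω₁) ∩ Metric.closedBall o (r + ρ) :=
    ⟨subset_closure hxε, by rw [mem_closedBall_iff_norm, hxo]; linarith⟩
  obtain ⟨z, ⟨hzc, hzb⟩, hzmax⟩ := (h.isCompact_closure.inter_right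
    Metric.isClosed_closedBall).exists_isMaxOn ⟨xε, hxεK⟩ hF
  have hFz : -c₁ < u z - W ‖z - o‖ := by
    refine lt_of_lt_of_le ?_ (hzmax hxεK)
    simp only [F, W, hxo, sub_self, mul_zero, pot_zero, zero_div, sub_zero]
    exact h.neg_lt hxε
  rw [mem_closedBall_iff_norm] at hzb
  have hz : z ∈ Ω₀ \ closure Ω₁ := by
    by_contra hz
    rcases h.mem_frontier_or hzc hz with hz | hz
    · rw [h.isOpen_outer.frontier_eq] at hz
      refine hz.2 (hδsub ?_)
      rw [Metric.mem_closedBall]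
      have := dist_triangle z o y
      rw [dist_eq_norm z o, dist_comm o y] at this
      linarith
    · rw [h.eq_inner z hz] at hFz
      linarith [hW0 ‖z - o‖]
  have hzlt : ‖z - o‖ < r + ρ := by
    refine hzb.lt_of_ne fun heq => ?_
    have h1 := h.add_le_pot_of_segment hP (t := ρ + ε) ho1 hz hoball
      (by rw [dist_comm, dist_eq_norm, heq]; linarith)
    have h2 : W ‖z - o‖ = pot g (κ * ρ) / κ := by
      simp only [W]
      rw [heq, add_sub_cancel_left]
    linarith
  have hmax : IsLocalMax F z := hzmax.isLocalMax <| by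
    refine inter_mem (mem_of_superset (h.isOpen_ring.mem_nhds hz) subset_closure) ?_
    exact Metric.closedBall_mem_nhds_of_mem (by rwa [mem_ball_iff_norm])
  have hzo : z ≠ o := fun he => hz.2 (subset_closure (he ▸ ho1))
  have hzo0 : 0 < ‖z - o‖ := norm_pos_iff.2 (sub_ne_zero.2 hzo)
  by_cases hs : κ * (‖z - o‖ - r) = 0
  · have h1 := (h.contDiffAt z hzc).hasGradientAt_gradient.hasFDerivAt.sub
      (hasGradientAt_radial hzo (hWd ‖z - o‖)).hasFDerivAt
    have h2 := hmax.hasFDerivAt_eq_zero h1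
    rw [hs, fluxInv_zero hg] at h2
    exact h.fderiv_ne hz (by simpa using h2)
  · have hcomp := le_radial_divergence b hg (h.contDiffAt z hzc) (h.gradient_ne z hz)
      (h.div_eq z hz) hzo (Eventually.of_forall hWd) (θ' := κ * 1)
      (((hasDerivAt_id _).sub_const r).const_mul κ) hs one_ne_zero
      (by simpa only [one_mul] using hmax)
    have hquot : κ * (‖z - o‖ - r) * (N - 1) / ‖z - o‖ ≤ κ * (1 / 4) := by
      rw [div_le_iff₀ hzo0]
      rcases le_total ‖z - o‖ r with hzr | hzr
      · nlinarith [mul_nonneg (sub_nonneg.2 hzr) (show (0 : ℝ) ≤ N - 1 by linarith)]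
      · nlinarith [mul_le_mul_of_nonneg_right (show ‖z - o‖ - r ≤ ρ by linarith)
          (show (0 : ℝ) ≤ N - 1 by linarith)]
    linarith

end IsRingSolution

end Bounds

section LowerBound

open scoped InnerProductSpace

/-- Directions of descent point into an open set on whose boundary the function vanishes. -/
theorem eventually_mem_of_inner_neg {E : Type*} [NormedAddCommGroup E] [InnerProductSpace ℝ E]
    [CompleteSpace E] {Ω : Set E} {u : E → ℝ} {x G p e : E} (hΩ : IsOpen Ω) (hconv : Convex ℝ Ω)
    (hu0 : ∀ y ∈ frontier Ω, u y = 0) (hx : x ∈ frontier Ω) (hG : HasGradientAt u G x)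
    (hp : p ∈ Ω) (hGp : ⟪G, p - x⟫_ℝ < 0) (hGe : ⟪G, e⟫_ℝ < 0) :
    ∀ᶠ t in nhdsWithin (0 : ℝ) (Ioi 0), x + t • e ∈ Ω := by
  set m := min (-⟪G, p - x⟫_ℝ) (-⟪G, e⟫_ℝ)
  have hm : 0 < m := lt_min (by linarith) (by linarith)
  set L := max ‖p - x‖ ‖e‖ + 1
  have hL : 0 < L := by positivity
  have hdiff := (hasGradientAt_iff_isLittleO.1 hG).bound (div_pos hm (mul_pos two_pos hL))
  obtain ⟨δ, hδ, hball⟩ := Metric.eventually_nhds_iff_ball.1 hdiff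
  filter_upwards [Ioo_mem_nhdsGT (lt_min (div_pos hδ hL) one_pos)] with t ht
  have ht0 : 0 < t := ht.1
  have htδ : t * L < δ := (lt_div_iff₀ hL).1 (ht.2.trans_le (min_le_left _ _))
  by_contra hcon
  have hy : x + t • (p - x) ∈ Ω := by
    have := hconv.combo_interior_closure_mem_interior (x := p) (y := x) (a := t) (b := 1 - t)
      (by rwa [hΩ.interior_eq]) (frontier_subset_closure hx) ht0
      (sub_nonneg.2 (ht.2.trans_le (min_le_right _ _)).le) (by ring)
    rw [hΩ.interior_eq] at this
    convert this using 1
    module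
  obtain ⟨w, hw, hwf, -⟩ := exists_mem_frontier_segment hΩ.isClosed_compl hcon (not_not.2 hy)
  rw [frontier_compl] at hwf
  obtain ⟨a, c, ha, hc, hac, rfl⟩ := hw
  set d := a • e + c • (p - x)
  have hwd : a • (x + t • e) + c • (x + t • (p - x)) = x + t • d := by
    have : a • (x + t • e) + c • (x + t • (p - x)) = (a + c) • x + t • d := by
      simp only [d]
      module
    rw [this, hac, one_smul]
  rw [hwd] at hwf
  have hdL : ‖d‖ ≤ L := by
    have := norm_add_le (a • e) (c • (p - x))
    rw [norm_smul, norm_smul, Real.norm_of_nonneg ha, Real.norm_of_nonneg hc] at this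
    have h1 : ‖p - x‖ ≤ max ‖p - x‖ ‖e‖ := le_max_left _ _
    have h2 : ‖e‖ ≤ max ‖p - x‖ ‖e‖ := le_max_right _ _
    have h3 := mul_le_mul_of_nonneg_left h1 hc
    have h4 := mul_le_mul_of_nonneg_left h2 ha
    have h5 : a * max ‖p - x‖ ‖e‖ + c * max ‖p - x‖ ‖e‖ = max ‖p - x‖ ‖e‖ := by
      rw [← add_mul, hac, one_mul]
    simp only [d, L]
    linarith
  have hdm : ⟪G, d⟫_ℝ ≤ -m := by
    have h1 : m ≤ -⟪G, p - x⟫_ℝ := min_le_left _ _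
    have h2 : m ≤ -⟪G, e⟫_ℝ := min_le_right _ _
    simp only [d]
    rw [inner_add_right, real_inner_smul_right, real_inner_smul_right]
    have h5 : a * m + c * m = m := by rw [← add_mul, hac, one_mul]
    nlinarith [mul_le_mul_of_nonneg_left h1 hc, mul_le_mul_of_nonneg_left h2 ha]
  have htd : ‖t • d‖ ≤ t * L := by
    rw [norm_smul, Real.norm_of_nonneg ht0.le]
    gcongr
  have hlin := hball (x + t • d) (by
    rw [Metric.mem_ball, dist_eq_norm, add_sub_cancel_left]
    linarith)
  rw [hu0 _ hwf, hu0 x hx, add_sub_cancel_left, real_inner_smul_right, Real.norm_eq_abs] at hlin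
  have h6 := (le_abs_self _).trans hlin
  have h7 : m / (2 * L) * ‖t • d‖ ≤ t * m / 2 := by
    calc m / (2 * L) * ‖t • d‖ ≤ m / (2 * L) * (t * L) := by gcongr
      _ = t * m / 2 := by field_simp
  have h8 := mul_le_mul_of_nonneg_left hdm ht0.le
  linarith [mul_pos ht0 hm]

namespace IsRingSolution

variable {E : Type*} [NormedAddCommGroup E] [InnerProductSpace ℝ E] [CompleteSpace E] {N : ℕ}
  {b : OrthonormalBasis (Fin N) ℝ E} {g : ℝ → ℝ} {Ω₀ Ω₁ : Set E} {q₀ c₁ : ℝ} {u : E → ℝ}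

theorem exists_farthest (h : IsRingSolution b g Ω₀ Ω₁ q₀ c₁ u) (o : E) :
    ∃ x ∈ frontier Ω₀, Ω₀ ⊆ Metric.ball o ‖x - o‖ := by
  have := h.nontrivial
  have := b.properSpace
  obtain ⟨x, hx, hmax⟩ := h.isBounded_outer.isCompact_closure.exists_isMaxOn
    ((h.nonempty_inner.mono (subset_closure.trans h.closure_subset)).mono subset_closure)
    (f := fun x => ‖x - o‖) (by fun_prop)
  have hsub : Ω₀ ⊆ Metric.ball o ‖x - o‖ := by
    rw [← interior_closedBall', h.isOpen_outer.subset_interior_iff]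
    exact fun y hy => mem_closedBall_iff_norm.2 (hmax (subset_closure hy))
  refine ⟨x, ?_, hsub⟩
  rw [h.isOpen_outer.frontier_eq]
  exact ⟨hx, fun hx0 => (mem_ball_iff_norm.1 (hsub hx0)).false⟩

theorem isLocalMaxOn (h : IsRingSolution b g Ω₀ Ω₁ q₀ c₁ u) {x : E} (hx : x ∈ frontier Ω₀) :
    IsLocalMaxOn u (closure Ω₀) x := by
  have hx1 : x ∉ closure Ω₁ := fun hc => by
    rw [h.isOpen_outer.frontier_eq] at hx
    exact hx.2 (h.closure_subset hc)
  filter_upwards [mem_nhdsWithin_of_mem_nhds (isClosed_closure.isOpen_compl.mem_nhds hx1),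
    self_mem_nhdsWithin] with y hy1 hy0
  rw [h.eq_outer x hx]
  refine h.nonpos ?_
  have := (isClosed_closure (s := Ω₁)).isOpen_compl.inter_closure ⟨hy1, hy0⟩
  rwa [inter_comm] at this

theorem exists_inner_neg (h : IsRingSolution b g Ω₀ Ω₁ q₀ c₁ u) {x : E} (hx : x ∈ frontier Ω₀) :
    ∃ p ∈ Ω₀, ⟪gradient u x, p - x⟫_ℝ < 0 := by
  obtain ⟨o, ho⟩ := h.nonempty_inner
  have ho0 := h.closure_subset (subset_closure ho)
  have hle : ⟪gradient u x, o - x⟫_ℝ ≤ 0 :=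
    (h.isLocalMaxOn hx).hasFDerivWithinAt_nonpos
      (h.contDiffAt x
        (h.frontier_outer_subset hx)).hasGradientAt_gradient.hasFDerivAt.hasFDerivWithinAt
      (sub_mem_posTangentConeAt_of_segment_subset
        (h.convex_outer.closure.segment_subset (frontier_subset_closure hx) (subset_closure ho0)))
  have hc : Tendsto (fun τ : ℝ => o - τ • gradient u x) (nhdsWithin 0 (Ioi 0)) (nhds o) := by
    have : Continuous fun τ : ℝ => o - τ • gradient u x := by fun_prop
    simpa using (this.tendsto 0).mono_left nhdsWithin_le_nhds
  obtain ⟨τ, hτ, hτ0⟩ := ((hc.eventually (h.isOpen_outer.mem_nhds ho0)).and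
    self_mem_nhdsWithin).exists
  refine ⟨_, hτ, ?_⟩
  rw [sub_right_comm, inner_sub_right, real_inner_smul_right, real_inner_self_eq_norm_sq,
    h.norm_gradient_outer x hx]
  have := mul_pos (mem_Ioi.1 hτ0) (pow_pos h.q_pos 2)
  linarith

/-- Distance estimate from the outer boundary when the `P`-function with slope `N` is bounded by
its value on that boundary. -/
theorem pot_sub_le_of_segment (h : IsRingSolution b g Ω₀ Ω₁ q₀ c₁ u) {R ρ : ℝ}
    (hP : ∀ x ∈ closure (Ω₀ \ closure Ω₁), pot g (flux g ‖gradient u x‖) ≤ pot g R + N * u x)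
    (hR : 0 ≤ R) (hρ : N * ρ ≤ R) {z y : E} (hz : z ∈ Ω₀ \ closure Ω₁) (hy : y ∉ Ω₀)
    (hseg : ∀ w ∈ segment ℝ y z, w ∉ closure Ω₁) (hd : ‖y - z‖ ≤ ρ) :
    pot g (R - N * ρ) ≤ pot g R + N * u z := by
  have hg := h.cond
  obtain ⟨w, hw, hwf, hwz⟩ :=
    exists_mem_frontier_segment h.isOpen_outer.isClosed_compl hy (not_not.2 hz.1)
  rw [frontier_compl] at hwf
  have hwseg : segment ℝ w z ⊆ segment ℝ y z :=
    (convex_segment y z).segment_subset hw (right_mem_segment ℝ y z)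
  have hsub : segment ℝ z w ⊆ closure (Ω₀ \ closure Ω₁) := fun p hp => by
    rw [segment_symm] at hp
    by_cases hpw : p = w
    · rw [hpw]; exact h.frontier_outer_subset hwf
    · exact subset_closure ⟨not_not.1 (hwz p hp hpw), hseg p (hwseg hp)⟩
  have hzc : z ∈ closure (Ω₀ \ closure Ω₁) := subset_closure hz
  obtain ⟨m, hm, hmz⟩ := intermediate_value_Icc hR (continuous_pot hg).continuousOn
    (show pot g R + N * u z ∈ Icc (pot g 0) (pot g R) by
      rw [pot_zero]
      exact ⟨(pot_nonneg hg _).trans (hP z hzc),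
        by linarith [mul_nonneg (Nat.cast_nonneg (α := ℝ) N) (neg_nonneg.2 (h.nonpos hzc))]⟩)
  have hle := add_mul_le_pot_of_segment hg (Nat.cast_nonneg N) hm.1
    (fun p hp => (h.contDiffAt p (hsub hp)).differentiableAt (by norm_num))
    (fun p hp => hP p (hsub hp)) hmz.ge
  rw [h.eq_outer w hwf, mul_zero, add_zero] at hle
  have hlen : ‖w - z‖ ≤ ρ := by
    have hsum := dist_add_dist_of_mem_segment hw
    rw [dist_eq_norm w z, dist_eq_norm y z] at hsum
    linarith [dist_nonneg (x := y) (y := w)]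
  have hmono := strictMonoOn_pot hg
  have hRm := (hmono.le_iff_le hR
    (add_nonneg hm.1 (mul_nonneg (Nat.cast_nonneg N) (norm_nonneg _)))).1 hle
  rw [← hmz]
  refine hmono.monotoneOn (sub_nonneg.2 hρ) hm.1 ?_
  linarith [mul_le_mul_of_nonneg_left hlen (Nat.cast_nonneg (α := ℝ) N)]

/-- A radial lower bound near the sphere about `o` circumscribed to the outer domain. -/
theorem radial_le (h : IsRingSolution b g Ω₀ Ω₁ q₀ c₁ u) {o : E} {R κ R₀ ρ : ℝ} (hκ : 0 < κ)
    (ho : o ∈ closure Ω₁) (hΩ₀ : Ω₀ ⊆ Metric.ball o R₀) (hΩ₁ : closure Ω₁ ⊆ Metric.ball o (R₀ - ρ))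
    (hρR : κ * ρ < R) (hκN : (N - κ) * R₀ < (R - κ * ρ) * (N - 1))
    (hsphere : ∀ x ∈ Ω₀ \ closure Ω₁, ‖x - o‖ = R₀ - ρ → (pot g (R - κ * ρ) - pot g R) / κ < u x)
    {x : E} (hx : x ∈ closure (Ω₀ \ closure Ω₁)) (hxρ : R₀ - ρ ≤ ‖x - o‖) :
    (pot g (R - κ * (R₀ - ‖x - o‖)) - pot g R) / κ ≤ u x := by
  have hg := h.cond
  set W : ℝ → ℝ := fun t => (pot g (R - κ * (R₀ - t)) - pot g R) / κ
  have hθ : ∀ t, HasDerivAt (fun t => R - κ * (R₀ - t)) κ t := fun t =>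
    ((((hasDerivAt_id t).const_sub R₀).const_mul κ).const_sub R).congr_deriv (by ring)
  have hW : ∀ t, HasDerivAt W (fluxInv g (R - κ * (R₀ - t))) t := fun t =>
    ((((hasDerivAt_pot hg _).comp t (hθ t)).sub_const _).div_const κ).congr_deriv
      (mul_div_cancel_right₀ _ hκ.ne')
  by_contra! hneg
  have hmem : ∀ y, y ∈ (Metric.ball o (R₀ - ρ))ᶜ ↔ R₀ - ρ ≤ ‖y - o‖ := by simp [dist_eq_norm]
  set F : E → ℝ := fun x => u x - W ‖x - o‖
  have hF : ContinuousOn F (closure (Ω₀ \ closure Ω₁) ∩ (Metric.ball o (R₀ - ρ))ᶜ) := by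
    have hWc : Continuous W := continuous_iff_continuousAt.2 fun t => (hW t).continuousAt
    exact (h.continuousOn.mono inter_subset_left).sub (hWc.comp (by fun_prop)).continuousOn
  obtain ⟨z, ⟨hzc, hzρ⟩, hzmin⟩ := (h.isCompact_closure.inter_right
    Metric.isOpen_ball.isClosed_compl).exists_isMinOn ⟨x, hx, (hmem x).2 hxρ⟩ hF
  have hFz : u z < W ‖z - o‖ := by
    have : F z ≤ F x := hzmin ⟨hx, (hmem x).2 hxρ⟩
    simp only [F] at this
    linarith
  rw [hmem] at hzρ
  have hz1 : z ∉ closure Ω₁ := fun hc => (mem_ball_iff_norm.1 (hΩ₁ hc)).not_ge hzρ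
  have hzR : ‖z - o‖ ≤ R₀ := mem_closedBall_iff_norm.1
    (closure_minimal (sdiff_subset.trans (hΩ₀.trans Metric.ball_subset_closedBall))
      Metric.isClosed_closedBall hzc)
  have hθρ : R - κ * ρ ≤ R - κ * (R₀ - ‖z - o‖) := by
    have := mul_le_mul_of_nonneg_left (show R₀ - ‖z - o‖ ≤ ρ by linarith) hκ.le
    linarith
  have hθ0 : 0 < R - κ * (R₀ - ‖z - o‖) := by linarith
  have hz : z ∈ Ω₀ \ closure Ω₁ := by
    by_contra hz
    rcases h.mem_frontier_or hzc hz with hz | hz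
    · rw [h.eq_outer z hz] at hFz
      refine hFz.not_ge (div_nonpos_of_nonpos_of_nonneg (sub_nonpos.2 ?_) hκ.le)
      have := mul_nonneg hκ.le (sub_nonneg.2 hzR)
      exact (strictMonoOn_pot hg).monotoneOn hθ0.le (mem_Ici.2 (by linarith)) (by linarith)
    · exact hz1 (frontier_subset_closure hz)
  have hzlt : R₀ - ρ < ‖z - o‖ := by
    refine hzρ.lt_of_ne fun heq => hFz.not_gt ?_
    have := hsphere z hz heq.symm
    simp only [W]
    rwa [← heq, sub_sub_cancel]
  have hmin : IsLocalMin F z := hzmin.isLocalMin <| by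
    refine inter_mem (mem_of_superset (h.isOpen_ring.mem_nhds hz) subset_closure) ?_
    have hnorm : ∀ᶠ y in nhds z, R₀ - ρ < ‖y - o‖ :=
      (isOpen_lt continuous_const (by fun_prop)).mem_nhds hzlt
    exact hnorm.mono fun y hy => (hmem y).2 hy.le
  have hzo : z ≠ o := fun he => hz1 (he ▸ ho)
  have hzo0 : 0 < ‖z - o‖ := norm_pos_iff.2 (sub_ne_zero.2 hzo)
  have hN : (2 : ℝ) ≤ N := by exact_mod_cast h.two_le
  have hcomp := le_radial_divergence b hg (h.contDiffAt z hzc) (h.gradient_ne z hz)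
    (h.div_eq z hz) hzo (Eventually.of_forall hW) (hθ _) hθ0.ne' (neg_ne_zero.2 one_ne_zero)
    (k := -1) (by simpa only [neg_one_mul] using hmin.neg)
  have hquot : N - κ < (R - κ * (R₀ - ‖z - o‖)) * (N - 1) / ‖z - o‖ := by
    rw [lt_div_iff₀ hzo0]
    have h1 : 0 < R - κ * ρ := by linarith
    rcases le_total (N : ℝ) κ with hle | hle
    · have : 0 < (R - κ * (R₀ - ‖z - o‖)) * (N - 1) := mul_pos hθ0 (by linarith)
      nlinarith
    · nlinarith [mul_le_mul_of_nonneg_left hzR (sub_nonneg.2 hle),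
        mul_le_mul_of_nonneg_right hθρ (show (0 : ℝ) ≤ N - 1 by linarith)]
  linarith

/-- The radial lower bound touches the solution at a farthest point of the outer boundary, where
it bounds the boundary gradient. -/
theorem le_fluxInv_of_radial_le (h : IsRingSolution b g Ω₀ Ω₁ q₀ c₁ u) {o x : E} {R κ ρ : ℝ}
    (hκ : 0 < κ) (hR : 0 ≤ R) (hρ : 0 < ρ) (hx : x ∈ frontier Ω₀) (hxo : x ≠ o)
    (hle : ∀ y ∈ closure (Ω₀ \ closure Ω₁), ‖x - o‖ - ρ ≤ ‖y - o‖ →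
      (pot g (R - κ * (‖x - o‖ - ‖y - o‖)) - pot g R) / κ ≤ u y) :
    q₀ ≤ fluxInv g R := by
  have hg := h.cond
  have hxc := h.frontier_outer_subset hx
  have hG := (h.contDiffAt x hxc).hasGradientAt_gradient
  set G := gradient u x
  set W : ℝ → ℝ := fun t => (pot g (R - κ * (‖x - o‖ - t)) - pot g R) / κ
  have hW : HasDerivAt W (fluxInv g R) ‖x - o‖ := by
    have hθ : HasDerivAt (fun t => R - κ * (‖x - o‖ - t)) κ ‖x - o‖ :=
      ((((hasDerivAt_id _).const_sub ‖x - o‖).const_mul κ).const_sub R).congr_deriv (by ring)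
    refine ((((hasDerivAt_pot hg _).comp _ hθ).sub_const _).div_const κ).congr_deriv ?_
    rw [mul_div_cancel_right₀ _ hκ.ne', sub_self, mul_zero, sub_zero]
  have hF := hG.hasFDerivAt.sub (hasGradientAt_radial hxo hW).hasFDerivAt
  obtain ⟨p, hp, hGp⟩ := h.exists_inner_neg hx
  have hGG : ⟪G, -G⟫_ℝ = -q₀ ^ 2 := by
    rw [inner_neg_right, real_inner_self_eq_norm_sq, h.norm_gradient_outer x hx]
  have hin := eventually_mem_of_inner_neg h.isOpen_outer h.convex_outer h.eq_outer hx hG hp hGp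
    (e := -G) (by rw [hGG]; linarith [pow_pos h.q_pos 2])
  have hx1 : x ∉ closure Ω₁ := fun hc => by
    rw [h.isOpen_outer.frontier_eq] at hx
    exact hx.2 (h.closure_subset hc)
  have hmin : IsLocalMinOn (u - fun y => W ‖y - o‖) (closure Ω₀) x := by
    have hnorm : ∀ᶠ y in nhds x, ‖x - o‖ - ρ < ‖y - o‖ :=
      (isOpen_lt continuous_const (by fun_prop)).mem_nhds (sub_lt_self _ hρ)
    filter_upwards [mem_nhdsWithin_of_mem_nhds (isClosed_closure.isOpen_compl.mem_nhds hx1),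
      self_mem_nhdsWithin, mem_nhdsWithin_of_mem_nhds hnorm] with y hy1 hy0 hyρ
    have := (isClosed_closure (s := Ω₁)).isOpen_compl.inter_closure ⟨hy1, hy0⟩
    rw [inter_comm] at this
    have := hle y this hyρ.le
    simp only [Pi.sub_apply, W, sub_self, mul_zero, sub_zero, zero_div, h.eq_outer x hx]
    linarith
  obtain ⟨t, htΩ, ht⟩ := (hin.and self_mem_nhdsWithin).exists
  have ht0 : 0 < t := ht
  have hnonneg := hmin.hasFDerivWithinAt_nonneg hF.hasFDerivWithinAt
    (sub_mem_posTangentConeAt_of_segment_subset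
      (h.convex_outer.closure.segment_subset (frontier_subset_closure hx) (subset_closure htΩ)))
  have hdir : 0 ≤ t * (-q₀ ^ 2 + fluxInv g R / ‖x - o‖ * ⟪x - o, G⟫_ℝ) := by
    have : 0 ≤ ⟪G, x + t • -G - x⟫_ℝ - ⟪(fluxInv g R / ‖x - o‖) • (x - o), x + t • -G - x⟫_ℝ :=
      hnonneg
    rw [add_sub_cancel_left, real_inner_smul_right, hGG, real_inner_smul_right,
      real_inner_smul_left, inner_neg_right] at this
    linarith
  have hxo0 : 0 < ‖x - o‖ := norm_pos_iff.2 (sub_ne_zero.2 hxo)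
  have hψ : 0 ≤ fluxInv g R := by
    rw [← fluxInv_zero hg]; exact (strictMono_fluxInv hg).monotone hR
  have hcs : fluxInv g R / ‖x - o‖ * ⟪x - o, G⟫_ℝ ≤ fluxInv g R * q₀ := by
    calc fluxInv g R / ‖x - o‖ * ⟪x - o, G⟫_ℝ
        ≤ fluxInv g R / ‖x - o‖ * (‖x - o‖ * ‖G‖) := by
          gcongr
          exact real_inner_le_norm _ _
      _ = fluxInv g R * q₀ := by
          rw [h.norm_gradient_outer x hx]
          field_simp
  have := nonneg_of_mul_nonneg_right hdir ht0
  exact le_of_mul_le_mul_right (by linarith) h.q_pos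

theorem pot_flux_lt (h : IsRingSolution b g Ω₀ Ω₁ q₀ c₁ u) : pot g (flux g q₀) < N * c₁ := by
  by_contra! hle
  have hg := h.cond
  have hN : (2 : ℝ) ≤ N := by exact_mod_cast h.two_le
  set R := flux g q₀ with hR_def
  have hR : 0 < R := flux_pos hg h.q_pos
  have hP : ∀ x ∈ closure (Ω₀ \ closure Ω₁), pot g (flux g ‖gradient u x‖) ≤ pot g R + N * u x :=
    fun x hx => h.pot_flux_le (Or.inr rfl) le_rfl hle hx
  have := b.properSpace
  obtain ⟨o, ho⟩ := h.nonempty_inner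
  have hoc := subset_closure ho
  obtain ⟨x, hx, hball⟩ := h.exists_farthest o
  set R₀ := ‖x - o‖ with hR₀_def
  have hR₀ : 0 < R₀ := by simpa using mem_ball_iff_norm.1 (hball (h.closure_subset hoc))
  obtain ⟨ρ, hρ, hρR, hρN, hball₁⟩ : ∃ ρ > 0, ρ < R₀ ∧ N * ρ ≤ R / 4 ∧
      closure Ω₁ ⊆ Metric.ball o (R₀ - ρ) := by
    have hcomp : IsCompact (closure Ω₁) :=
      (h.isBounded_outer.subset (subset_closure.trans h.closure_subset)).isCompact_closure
    obtain ⟨y, hy, hymax⟩ := hcomp.exists_isMaxOn ⟨o, hoc⟩ (f := fun y => ‖y - o‖) (by fun_prop)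
    have hylt : ‖y - o‖ < R₀ := mem_ball_iff_norm.1 (hball (h.closure_subset hy))
    have hmin₁ := min_le_left ((R₀ - ‖y - o‖) / 2) (R / 4 / N)
    refine ⟨min ((R₀ - ‖y - o‖) / 2) (R / 4 / N), lt_min (by linarith) (by positivity),
      by linarith [norm_nonneg (y - o)], ?_, fun w hw => ?_⟩
    · rw [mul_comm, ← le_div_iff₀ (by positivity)]
      exact min_le_right _ _
    · have : ‖w - o‖ ≤ ‖y - o‖ := hymax hw
      rw [mem_ball_iff_norm]
      linarith
  obtain ⟨κ, hκ1, hκN, hκR⟩ : ∃ κ : ℝ, 1 ≤ κ ∧ κ < N ∧ (N - κ) * R₀ < R / 4 * (N - 1) := by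
    have hN1 : (0 : ℝ) < N - 1 := by linarith
    have hpos : 0 < R / 8 * (N - 1) / R₀ := by positivity
    refine ⟨N - min 1 (R / 8 * (N - 1) / R₀), ?_, ?_, ?_⟩
    · linarith [min_le_left 1 (R / 8 * (N - 1) / R₀)]
    · linarith [lt_min one_pos hpos]
    · rw [sub_sub_cancel]
      have h1 := (le_div_iff₀ hR₀).1 (min_le_right 1 (R / 8 * (N - 1) / R₀))
      linarith [mul_pos hR hN1]
  have hκ0 : 0 < κ := by linarith
  have hκρ : κ * ρ < N * ρ := by gcongr
  have hsec : (pot g (R - κ * ρ) - pot g R) / κ < (pot g (R - N * ρ) - pot g R) / N := by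
    have h1 := (strictConvexOn_pot hg).secant_strict_mono (mem_univ R) (mem_univ (R - N * ρ))
      (mem_univ (R - κ * ρ)) (sub_lt_self _ (by positivity)).ne
      (sub_lt_self _ (by positivity)).ne (by linarith)
    rw [sub_sub_cancel_left, sub_sub_cancel_left, div_neg, div_neg, neg_lt_neg_iff, ← div_div,
      ← div_div] at h1
    exact lt_of_mul_lt_mul_right (by simpa only [div_eq_mul_inv] using h1) (inv_pos.2 hρ).le
  obtain ⟨R', hR'2, hR'R, hsec'⟩ : ∃ R', R / 2 < R' ∧ R' < R ∧
      (pot g (R' - κ * ρ) - pot g R') / κ < (pot g (R - N * ρ) - pot g R) / N := by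
    have hc : Continuous fun R' => (pot g (R' - κ * ρ) - pot g R') / κ :=
      (((continuous_pot hg).comp (by fun_prop)).sub (continuous_pot hg)).div_const κ
    have hev := ((hc.tendsto R).eventually (gt_mem_nhds hsec)).filter_mono
      (nhdsWithin_le_nhds (s := Iio R))
    obtain ⟨R', h1, h2⟩ := (hev.and (Ioo_mem_nhdsLT (show R / 2 < R by linarith))).exists
    exact ⟨R', h2.1, h2.2, h1⟩
  have hsphere : ∀ z ∈ Ω₀ \ closure Ω₁, ‖z - o‖ = R₀ - ρ →
      (pot g (R' - κ * ρ) - pot g R') / κ < u z := fun z hz hzρ => by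
    set y := o + (R₀ / (R₀ - ρ)) • (z - o) with hy_def
    have hRρ : 0 < R₀ - ρ := by linarith
    have hyo : ‖y - o‖ = R₀ := by
      rw [hy_def, add_sub_cancel_left, norm_smul, hzρ, Real.norm_of_nonneg (by positivity)]
      field_simp
    have hyz : ‖y - z‖ = ρ := by
      have h1 : y - z = (ρ / (R₀ - ρ)) • (z - o) := by
        have : R₀ / (R₀ - ρ) = 1 + ρ / (R₀ - ρ) := by field_simp; ring
        rw [hy_def, this]
        module
      rw [h1, norm_smul, hzρ, Real.norm_of_nonneg (by positivity)]
      field_simp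
    have hlow := h.pot_sub_le_of_segment hP hR.le (ρ := ρ) (by linarith) hz (y := y)
      (fun hy => (mem_ball_iff_norm.1 (hball hy)).ne hyo) (fun w hw hwc => ?_) hyz.le
    · refine hsec'.trans_le ?_
      rw [div_le_iff₀ (by linarith)]
      linarith
    · have h1 := dist_add_dist_of_mem_segment hw
      have h2 := mem_ball_iff_norm.1 (hball₁ hwc)
      have h3 := norm_sub_le_norm_sub_add_norm_sub y w o
      rw [dist_eq_norm y w, dist_eq_norm y z] at h1
      linarith [dist_nonneg (x := w) (y := z)]
  have hxo : x ≠ o := fun he => hR₀.ne' (by simp [hR₀_def, he])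
  have hκρR : R / 4 < R' - κ * ρ := by linarith
  have hfin := h.le_fluxInv_of_radial_le hκ0 (by linarith) hρ hx hxo fun y hy hyρ =>
    h.radial_le hκ0 hoc hball hball₁ (by linarith)
      (hκR.trans (by gcongr; linarith)) hsphere hy hyρ
  have := strictMono_fluxInv hg hR'R
  rw [hR_def, fluxInv_flux hg] at this
  linarith

end IsRingSolution

end LowerBound

/-- Necessity of inequalities (3.5) in the paper's Theorem 3.1: if the overdetermined
problem (3.1)–(3.3) has a solution on the ring-shaped domain `Ω = Ω₀ \ closure Ω₁`,
then `(1/N)∫₀^{q₀} s G(s²) ds < c₁ < ∫₀^{q₀} s G(s²) ds`. -/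
theorem stmt10 (N : ℕ) (hN : 2 ≤ N) (g : ℝ → ℝ) (hg : Cond24 g)
    (Ω₀ Ω₁ : Set (EuclideanSpace ℝ (Fin N)))
    (hΩ₀open : IsOpen Ω₀) (hΩ₁open : IsOpen Ω₁)
    (hΩ₀bdd : Bornology.IsBounded Ω₀) (hΩ₁bdd : Bornology.IsBounded Ω₁)
    (hΩ₀conv : Convex ℝ Ω₀) (hΩ₁conv : Convex ℝ Ω₁)
    (hΩ₀ne : Ω₀.Nonempty) (hΩ₁ne : Ω₁.Nonempty)
    (hsub : closure Ω₁ ⊆ Ω₀)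
    (q₀ c₁ : ℝ) (hq₀ : 0 < q₀) (hc₁ : 0 < c₁)
    (u : EuclideanSpace ℝ (Fin N) → ℝ)
    (U : Set (EuclideanSpace ℝ (Fin N))) (hU : IsOpen U)
    (hUsub : closure (Ω₀ \ closure Ω₁) ⊆ U) (hu : ContDiffOn ℝ 3 u U)
    (hgrad : ∀ x ∈ Ω₀ \ closure Ω₁, gradient u x ≠ 0)
    (hpde : ∀ x ∈ Ω₀ \ closure Ω₁,
      ∑ i, fderiv ℝ (fun y => g (‖gradient u y‖ ^ 2) * fderiv ℝ u y (eb N i)) x (eb N i)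
        = (N : ℝ))
    (hu0 : ∀ x ∈ frontier Ω₀, u x = 0)
    (hq0 : ∀ x ∈ frontier Ω₀, ‖gradient u x‖ = q₀)
    (hu1 : ∀ x ∈ frontier Ω₁, u x = -c₁)
    (hq1 : ∀ x ∈ frontier Ω₁, gradient u x = 0) :
    (1 / N : ℝ) * (∫ s in (0:ℝ)..q₀, s * Gfun g (s ^ 2)) < c₁ ∧
    c₁ < ∫ s in (0:ℝ)..q₀, s * Gfun g (s ^ 2) := by
  set b := EuclideanSpace.basisFun (Fin N) ℝ
  have hring : IsRingSolution b g Ω₀ Ω₁ q₀ c₁ u := by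
    have hdiff : ∀ x ∈ closure (Ω₀ \ closure Ω₁), ContDiffAt ℝ 3 u x :=
      fun x hx => hu.contDiffAt (hU.mem_nhds (hUsub hx))
    refine ⟨hN, hg, hΩ₀open, hΩ₁open, hΩ₀bdd, hΩ₀conv, hΩ₁conv, hΩ₁ne, hsub, hq₀, hc₁, hdiff,
      hgrad, fun x hx => ?_, hu0, hq0, hu1, hq1⟩
    rw [← hpde x hx]
    refine Finset.sum_congr rfl fun i _ => ?_
    have hv := (hasFDerivAt_vflux hg (hdiff x (subset_closure hx)) (hgrad x hx)).differentiableAt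
    have hcoord : (fun y => g (‖gradient u y‖ ^ 2) * fderiv ℝ u y (eb N i)) =
        fun y => inner ℝ (vflux g u y) (b i) := by
      funext y
      rw [vflux, real_inner_smul_left, inner_gradient_eq_fderiv]
      simp [b, eb]
    rw [hcoord, fderiv_inner_apply ℝ hv (differentiableAt_const _)]
    simp [b, eb]
  have hN0 : (0 : ℝ) < N := by exact_mod_cast two_pos.trans_le hN
  rw [integral_eq_pot_flux hg hq₀, one_div, inv_mul_lt_iff₀ hN0]
  exact ⟨hring.pot_flux_lt, hring.lt_pot_flux⟩

end
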